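/- arXiv:1902.07578 — 2 statements merged into one kernel-verified Lean document; each statement's English description precedes it below -/
import Mathlib

section
/- If f is a homeomorphism of a compact metric space with the L-shadowing property, then every chain recurrent class of f is either expansive (as a subsystem) or contains arbitrarily small topological semi-horseshoes. -/
open Filter Metric Set Topology

variable {X : Type*} [MetricSpace X]

/-- `f^k x` for `k : ℤ`, where `f` is a homeomorphism. -/
def iterZ (f : X ≃ₜ X) (k : ℤ) (x : X) : X :=
  if 0 ≤ k then (⇑f)^[k.toNat] x else (⇑f.symm)^[(-k).toNat] x

/-- The classical shadowing property. -/
def Shadowing (f : X ≃ₜ X) : Prop :=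
  ∀ ε > (0:ℝ), ∃ δ > (0:ℝ), ∀ x : ℤ → X,
    (∀ k : ℤ, dist (f (x k)) (x (k+1)) < δ) →
    ∃ z : X, ∀ k : ℤ, dist (iterZ f k z) (x k) < ε

/-- The L-shadowing property. -/
def LShadowing (f : X ≃ₜ X) : Prop :=
  ∀ ε > (0:ℝ), ∃ δ > (0:ℝ), ∀ x : ℤ → X,
    (∀ k : ℤ, dist (f (x k)) (x (k+1)) ≤ δ) →
    Tendsto (fun k : ℤ => dist (f (x k)) (x (k+1))) cofinite (nhds 0) →
    ∃ z : X, (∀ k : ℤ, dist (iterZ f k z) (x k) ≤ ε) ∧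
      Tendsto (fun k : ℤ => dist (iterZ f k z) (x k)) cofinite (nhds 0)

/-- The stable set of `x`. -/
def stableSet (f : X ≃ₜ X) (x : X) : Set X :=
  {y | Tendsto (fun n : ℕ => dist ((⇑f)^[n] x) ((⇑f)^[n] y)) atTop (nhds 0)}

/-- The unstable set of `x`. -/
def unstableSet (f : X ≃ₜ X) (x : X) : Set X := stableSet f.symm x

/-- The local stable set of size `ε` of `x`. -/
def localStable (f : X ≃ₜ X) (ε : ℝ) (x : X) : Set X :=
  {y | ∀ n : ℕ, dist ((⇑f)^[n] x) ((⇑f)^[n] y) ≤ ε}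

/-- The local unstable set of size `ε` of `x`. -/
def localUnstable (f : X ≃ₜ X) (ε : ℝ) (x : X) : Set X := localStable f.symm ε x

/-- `V^s_ε(x) = W^s(x) ∩ W^s_ε(x)`. -/
def Vs (f : X ≃ₜ X) (ε : ℝ) (x : X) : Set X := stableSet f x ∩ localStable f ε x

/-- `V^u_ε(x) = W^u(x) ∩ W^u_ε(x)`. -/
def Vu (f : X ≃ₜ X) (ε : ℝ) (x : X) : Set X := unstableSet f x ∩ localUnstable f ε x

/-- The limit shadowing property. -/
def LimitShadowing (f : X ≃ₜ X) : Prop :=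
  ∀ x : ℕ → X, Tendsto (fun k : ℕ => dist (f (x k)) (x (k+1))) atTop (nhds 0) →
    ∃ y : X, Tendsto (fun k : ℕ => dist ((⇑f)^[k] y) (x k)) atTop (nhds 0)

/-- The two-sided limit shadowing property. -/
def TwoSidedLimitShadowing (f : X ≃ₜ X) : Prop :=
  ∀ x : ℤ → X, Tendsto (fun k : ℤ => dist (f (x k)) (x (k+1))) cofinite (nhds 0) →
    ∃ y : X, Tendsto (fun k : ℤ => dist (iterZ f k y) (x k)) cofinite (nhds 0)

/-- A non-wandering point. -/
def NonWandering (f : X ≃ₜ X) (x : X) : Prop :=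
  ∀ U : Set X, IsOpen U → x ∈ U → ∃ k : ℕ, 0 < k ∧ ((⇑f)^[k] '' U ∩ U).Nonempty

/-- The non-wandering set. -/
def omegaSet (f : X ≃ₜ X) : Set X := {x | NonWandering f x}

/-- Topologically mixing. -/
def TopMixing (f : X ≃ₜ X) : Prop :=
  ∀ U V : Set X, IsOpen U → IsOpen V → U.Nonempty → V.Nonempty →
    ∃ n : ℕ, 0 < n ∧ ∀ k ≥ n, ((⇑f)^[k] '' U ∩ V).Nonempty

/-- `f` is expansive on the set `A` (as a subsystem). -/
def ExpansiveOn (f : X ≃ₜ X) (A : Set X) : Prop :=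
  ∃ c > (0:ℝ), ∀ x ∈ A, ∀ y ∈ A,
    (∀ k : ℤ, dist (iterZ f k x) (iterZ f k y) ≤ c) → x = y

/-- The dynamical ball `Γ_δ(x)`. -/
def dynBall (f : X ≃ₜ X) (δ : ℝ) (x : X) : Set X :=
  {y | ∀ k : ℤ, dist (iterZ f k x) (iterZ f k y) ≤ δ}

/-- There is a periodic `ε`-pseudo-orbit containing both `x` and `y`. -/
def ChainRel (f : X ≃ₜ X) (ε : ℝ) (x y : X) : Prop :=
  ∃ (n : ℕ) (z : ℕ → X), 0 < n ∧ z 0 = x ∧ z n = x ∧ (∃ i ≤ n, z i = y) ∧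
    ∀ i < n, dist (f (z i)) (z (i+1)) < ε

/-- The chain recurrent class of `x`. -/
def chainClass (f : X ≃ₜ X) (x : X) : Set X := {y | ∀ ε > (0:ℝ), ChainRel f ε x y}

/-- `h` is a semiconjugacy from `g` on `K` to the full shift on two symbols. -/
def SemiConjShift (g : X → X) (K : Set X) (h : X → (ℤ → Bool)) : Prop :=
  ContinuousOn h K ∧ (∀ s : ℤ → Bool, ∃ p ∈ K, h p = s) ∧
    ∀ p ∈ K, h (g p) = fun i => h p (i + 1)

/-- `f` admits arbitrarily small topological semi-horseshoes inside `C`. -/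
def SmallHorseshoes (f : X ≃ₜ X) (C : Set X) : Prop :=
  ∀ ε > (0:ℝ), ∃ N : ℕ, 1 ≤ N ∧ ∃ K : Set X, K ⊆ C ∧ IsCompact K ∧
    (⇑f)^[N] '' K = K ∧ (∀ k : ℤ, Metric.diam (iterZ f k '' K) ≤ ε) ∧
    ∃ h : X → (ℤ → Bool), SemiConjShift ((⇑f)^[N]) K h

section helpers

set_option linter.unusedSectionVars false

theorem iterZ_eq (f : X ≃ₜ X) (k : ℤ) (x : X) :
    iterZ f k x = ((f.toEquiv : Equiv.Perm X) ^ k) x := by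
  unfold iterZ
  split_ifs with h
  · obtain ⟨n, rfl⟩ := Int.eq_ofNat_of_zero_le h
    have : ((f.toEquiv : Equiv.Perm X) ^ n) x = (⇑f)^[n] x := by
      rw [← Equiv.Perm.iterate_eq_pow]; rfl
    simp [this]
  · obtain ⟨n, hn⟩ := Int.eq_ofNat_of_zero_le (show 0 ≤ -k by omega)
    obtain rfl : k = -(n : ℤ) := by omega
    have : (((f.toEquiv : Equiv.Perm X)⁻¹) ^ n) x = (⇑f.symm)^[n] x := by
      rw [← Equiv.Perm.iterate_eq_pow]; rfl
    simp [← this]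

theorem iterZ_add (f : X ≃ₜ X) (k l : ℤ) (x : X) :
    iterZ f (k + l) x = iterZ f k (iterZ f l x) := by
  simp only [iterZ_eq, zpow_add, Equiv.Perm.mul_apply]

theorem iterZ_zero (f : X ≃ₜ X) (x : X) : iterZ f 0 x = x := by
  simp [iterZ_eq]

theorem iterZ_one (f : X ≃ₜ X) (x : X) : iterZ f 1 x = f x := by
  simp [iterZ_eq]

theorem iterZ_succ (f : X ≃ₜ X) (k : ℤ) (x : X) :
    f (iterZ f k x) = iterZ f (k + 1) x := by
  rw [add_comm, iterZ_add, iterZ_one]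

theorem iterZ_natCast (f : X ≃ₜ X) (n : ℕ) (x : X) :
    iterZ f n x = (⇑f)^[n] x := by
  simp [iterZ]

theorem iterZ_cont (f : X ≃ₜ X) (k : ℤ) : Continuous (iterZ f k) := by
  unfold iterZ
  split_ifs
  · exact f.continuous.iterate _
  · exact f.symm.continuous.iterate _

theorem tg_fun {α : Type*} {r : α → α → Prop} {u v : α} (h : Relation.TransGen r u v) :
    ∃ (n : ℕ) (z : ℕ → α), 0 < n ∧ z 0 = u ∧ z n = v ∧ ∀ i < n, r (z i) (z (i+1)) := by
  induction h with
  | single h =>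
    rename_i b
    exact ⟨1, fun i => if i = 0 then u else b, by simp, by simp, by simp, by
      intro i hi; obtain rfl : i = 0 := by omega
      simpa using h⟩
  | tail _ h ih =>
    rename_i b c _
    obtain ⟨n, z, hn, h0, h1, h2⟩ := ih
    refine ⟨n+1, fun i => if i ≤ n then z i else c, by simp, by simpa using h0, by simp, ?_⟩
    intro i hi
    by_cases h' : i < n
    · have a1 : i ≤ n := by omega
      have a2 : i + 1 ≤ n := by omega
      simp only [a1, a2, if_true]; exact h2 i h'
    · obtain rfl : i = n := by omega
      simpa [h1] using h

theorem tg_loop {α : Type*} {r : α → α → Prop} {u v : α} (h : Relation.TransGen r u v)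
    (h' : Relation.TransGen r v u) :
    ∃ (n : ℕ) (z : ℕ → α) (i : ℕ), i < n ∧ z 0 = u ∧ z n = u ∧ z i = v ∧
      ∀ i < n, r (z i) (z (i+1)) := by
  obtain ⟨n, z, hn, h0, h1, h2⟩ := tg_fun h
  obtain ⟨m, w, hm, k0, k1, k2⟩ := tg_fun h'
  refine ⟨n + m, fun i => if i ≤ n then z i else w (i - n), n, by omega, by simpa using h0, ?_,
    by simpa using h1, ?_⟩
  · have : ¬ (n + m ≤ n) := by omega
    simp only [this, if_false]; simpa using k1
  · intro i hi
    by_cases a : i < n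
    · have a1 : i ≤ n := by omega
      have a2 : i + 1 ≤ n := by omega
      simp only [a1, a2, if_true]; exact h2 i a
    · have a2 : ¬ (i + 1 ≤ n) := by omega
      by_cases a1 : i ≤ n
      · obtain rfl : i = n := by omega
        simp only [le_refl, if_true, a2, if_false]
        have := k2 0 hm
        rw [k0] at this
        simpa [h1] using this
      · simp only [a1, a2, if_false]
        have := k2 (i - n) (by omega)
        rwa [show i - n + 1 = i + 1 - n by omega] at this

theorem fun_tg {α : Type*} {r : α → α → Prop} {z : ℕ → α} {n : ℕ}
    (h : ∀ i < n, r (z i) (z (i+1))) (i : ℕ) (d : ℕ) (hd : i + d + 1 ≤ n) :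
    Relation.TransGen r (z i) (z (i + d + 1)) := by
  induction d with
  | zero => exact .single (h i (by omega))
  | succ d ih => exact (ih (by omega)).tail (h _ (by omega))

theorem orb_rtg {α : Type*} {r : α → α → Prop} {z : ℤ → α}
    (h : ∀ i, r (z i) (z (i+1))) (i j : ℤ) (hij : i ≤ j) :
    Relation.ReflTransGen r (z i) (z j) := by
  obtain ⟨d, hd⟩ := Int.eq_ofNat_of_zero_le (show 0 ≤ j - i by omega)
  obtain rfl : j = i + d := by omega
  clear hij hd
  induction d with
  | zero => simpa using Relation.ReflTransGen.refl
  | succ d ih => exact ih.tail (by simpa [add_assoc] using h (i + d))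

/-- one step of an `ε`-chain -/
def Stp (f : X ≃ₜ X) (ε : ℝ) (u v : X) : Prop := dist (f u) v < ε

theorem mem_chainClass (f : X ≃ₜ X) (x y : X) :
    y ∈ chainClass f x ↔ ∀ ε > (0:ℝ), Relation.TransGen (Stp f ε) x y ∧
      Relation.TransGen (Stp f ε) y x := by
  constructor
  · intro h ε he
    obtain ⟨n, z, hn, h0, h1, ⟨i, hi, hiy⟩, hz⟩ := h ε he
    have hz' : ∀ i < n, Stp f ε (z i) (z (i+1)) := hz
    have hxx : Relation.TransGen (Stp f ε) x x := by
      have := fun_tg hz' 0 (n-1) (by omega)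
      rwa [h0, show 0 + (n-1) + 1 = n by omega, h1] at this
    rcases Nat.eq_zero_or_pos i with rfl | hp
    · rw [← hiy, h0]; exact ⟨hxx, hxx⟩
    rcases eq_or_lt_of_le hi with rfl | hl
    · rw [← hiy, h1]; exact ⟨hxx, hxx⟩
    constructor
    · have := fun_tg hz' 0 (i-1) (by omega)
      rwa [h0, show 0 + (i-1) + 1 = i by omega, hiy] at this
    · have := fun_tg hz' i (n-i-1) (by omega)
      rwa [show i + (n-i-1) + 1 = n by omega, hiy, h1] at this
  · intro h ε he
    obtain ⟨n, z, i, hi, h0, h1, h2, h3⟩ := tg_loop (h ε he).1 (h ε he).2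
    exact ⟨n, z, by omega, h0, h1, ⟨i, hi.le, h2⟩, h3⟩

theorem stp_mono (f : X ≃ₜ X) {ε ε' : ℝ} (h : ε ≤ ε') {u v : X}
    (H : Relation.TransGen (Stp f ε) u v) : Relation.TransGen (Stp f ε') u v :=
  Relation.TransGen.mono (fun _ _ hh => lt_of_lt_of_le hh h) _ _ H

theorem stp_orb (f : X ≃ₜ X) {ε : ℝ} (he : 0 < ε) (p : X) (k : ℤ) :
    Stp f ε (iterZ f k p) (iterZ f (k+1) p) := by
  simp [Stp, iterZ_succ, he]

variable [CompactSpace X]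

theorem uc (f : X ≃ₜ X) {ε : ℝ} (he : 0 < ε) :
    ∃ δ > 0, ∀ u v, dist u v < δ → dist (f u) (f v) < ε := by
  have := CompactSpace.uniformContinuous_of_continuous f.continuous
  obtain ⟨δ, hd, h⟩ := Metric.uniformContinuous_iff.1 this ε he
  exact ⟨δ, hd, fun u v => @h u v⟩

theorem chain_f (f : X ≃ₜ X) (y : X) (h : ∀ ε > (0:ℝ), Relation.TransGen (Stp f ε) y y) :
    ∀ ε > (0:ℝ), Relation.TransGen (Stp f ε) (f y) y := by
  intro ε he
  obtain ⟨δ, hd, hu⟩ := uc f (half_pos he)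
  set η := min δ (ε/2) with hη
  have hη0 : 0 < η := by positivity
  have H := h η hη0
  obtain ⟨v1, a1, b1⟩ := Relation.TransGen.head'_iff.1 H
  obtain ⟨v2, a2, b2⟩ := Relation.TransGen.head'_iff.1 (Relation.TransGen.trans_right b1 H)
  have hm : ∀ u v, Stp f η u v → Stp f ε u v := fun u v huv => by
    have : η ≤ ε/2 := min_le_right _ _
    unfold Stp at *; linarith
  refine Relation.TransGen.head' ?_ (Relation.ReflTransGen.mono hm _ _ b2)
  unfold Stp at *
  have c1 := hu _ _ (lt_of_lt_of_le a1 (min_le_left _ _))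
  have c2 : η ≤ ε/2 := min_le_right _ _
  linarith [dist_triangle (f (f y)) (f v1) v2]

theorem chain_fsymm (f : X ≃ₜ X) (y : X) (h : ∀ ε > (0:ℝ), Relation.TransGen (Stp f ε) y y) :
    ∀ ε > (0:ℝ), Relation.TransGen (Stp f ε) y (f.symm y) := by
  intro ε he
  obtain ⟨δ, hd, hu⟩ := uc f.symm (half_pos he)
  set η := min δ (ε/2) with hη
  have hη0 : 0 < η := by positivity
  have H := h η hη0
  obtain ⟨v1, b1, a1⟩ := Relation.TransGen.tail'_iff.1 H
  obtain ⟨v2, b2, a2⟩ := Relation.TransGen.tail'_iff.1 (H.trans_left b1)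
  have hm : ∀ u v, Stp f η u v → Stp f ε u v := fun u v huv => by
    have : η ≤ ε/2 := min_le_right _ _
    unfold Stp at *; linarith
  refine Relation.TransGen.tail' (Relation.ReflTransGen.mono hm _ _ b2) ?_
  unfold Stp at *
  have c1 := hu _ _ (lt_of_lt_of_le a1 (min_le_left _ _))
  have c2 : η ≤ ε/2 := min_le_right _ _
  rw [f.symm_apply_apply] at c1
  linarith [dist_triangle (f v2) v1 (f.symm y)]

theorem class_f (f : X ≃ₜ X) {x y : X} (h : y ∈ chainClass f x) : f y ∈ chainClass f x := by
  rw [mem_chainClass] at *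
  intro ε he
  have hs : Stp f ε y (f y) := by simp [Stp, he]
  refine ⟨(h ε he).1.tail hs, ?_⟩
  exact (chain_f f y (fun ε he => (h ε he).2.trans (h ε he).1) ε he).trans (h ε he).2

theorem class_fsymm (f : X ≃ₜ X) {x y : X} (h : y ∈ chainClass f x) :
    f.symm y ∈ chainClass f x := by
  rw [mem_chainClass] at *
  intro ε he
  have hs : Stp f ε (f.symm y) y := by simp [Stp, he]
  refine ⟨?_, (h ε he).2.head hs⟩
  exact (h ε he).1.trans (chain_fsymm f y (fun ε he => (h ε he).2.trans (h ε he).1) ε he)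

theorem class_iter (f : X ≃ₜ X) {x y : X} (h : y ∈ chainClass f x) (k : ℤ) :
    iterZ f k y ∈ chainClass f x := by
  unfold iterZ
  split_ifs
  · generalize k.toNat = n
    induction n with
    | zero => simpa using h
    | succ n ih => rw [Function.iterate_succ_apply']; exact class_f f ih
  · generalize (-k).toNat = n
    induction n with
    | zero => simpa using h
    | succ n ih => rw [Function.iterate_succ_apply']; exact class_fsymm f ih

theorem class_closed (f : X ≃ₜ X) (x : X) : IsClosed (chainClass f x) := by
  rw [← closure_subset_iff_isClosed]
  intro y hy
  rw [mem_chainClass]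
  intro ε he
  obtain ⟨δ, hd, hu⟩ := uc f (half_pos he)
  obtain ⟨y', hy', hyy⟩ := Metric.mem_closure_iff.1 hy (min δ (ε/2)) (by positivity)
  rw [mem_chainClass] at hy'
  obtain ⟨H1, H2⟩ := hy' (ε/2) (by positivity)
  have hm : ∀ u v, Stp f (ε/2) u v → Stp f ε u v := fun u v huv => by
    unfold Stp at *; linarith
  constructor
  · obtain ⟨v, b, a⟩ := Relation.TransGen.tail'_iff.1 H1
    refine Relation.TransGen.tail' (Relation.ReflTransGen.mono hm _ _ b) ?_
    unfold Stp at *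
    have := min_le_right δ (ε/2)
    linarith [dist_triangle (f v) y' y, dist_comm y y']
  · obtain ⟨v, a, b⟩ := Relation.TransGen.head'_iff.1 H2
    refine Relation.TransGen.head' ?_ (Relation.ReflTransGen.mono hm _ _ b)
    unfold Stp at *
    have := hu y y' (lt_of_lt_of_le hyy (min_le_left _ _))
    linarith [dist_triangle (f y) (f y') v]

theorem class_trans (f : X ≃ₜ X) {x y z : X} (hy : y ∈ chainClass f x) (hz : z ∈ chainClass f x)
    {ε : ℝ} (he : 0 < ε) : Relation.TransGen (Stp f ε) y z := by
  rw [mem_chainClass] at *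
  exact (hy ε he).2.trans (hz ε he).1


theorem link (f : X ≃ₜ X) (hL : LShadowing f) {ε : ℝ} (he : 0 < ε) :
    ∃ δ > 0, ∀ a b : X, dist a b ≤ δ → ∃ z,
      (∀ k < 0, dist (iterZ f k z) (iterZ f k a) ≤ ε) ∧
      (∀ k ≥ 0, dist (iterZ f k z) (iterZ f k b) ≤ ε) ∧
      Tendsto (fun k : ℤ => dist (iterZ f k z) (iterZ f k a)) atBot (nhds 0) ∧
      Tendsto (fun k : ℤ => dist (iterZ f k z) (iterZ f k b)) atTop (nhds 0) := by
  obtain ⟨δ, hd, H⟩ := hL ε he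
  refine ⟨δ, hd, fun a b hab => ?_⟩
  set y : ℤ → X := fun k => if k < 0 then iterZ f k a else iterZ f k b with hy
  have hj : ∀ k, k ≠ -1 → dist (f (y k)) (y (k+1)) = 0 := by
    intro k hk
    simp only [hy]
    by_cases h : k < 0
    · have : k + 1 < 0 := by omega
      simp [h, this, iterZ_succ]
    · have : ¬ (k + 1 < 0) := by omega
      simp [h, this, iterZ_succ]
  obtain ⟨z, hz, hzt⟩ := H y (by
    intro k
    by_cases hk : k = -1
    · subst hk
      simp [hy, iterZ_succ, iterZ_zero, hab]
    · rw [hj k hk]; exact hd.le) (by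
    refine Tendsto.congr' ?_ tendsto_const_nhds
    have : {k : ℤ | k ≠ -1} ∈ (cofinite : Filter ℤ) := by
      rw [mem_cofinite]; simp
    filter_upwards [this] with k hk
    exact (hj k hk).symm)
  rw [Int.cofinite_eq, tendsto_sup] at hzt
  refine ⟨z, ?_, ?_, ?_, ?_⟩
  · intro k hk; have := hz k; simpa [hy, hk] using this
  · intro k hk; have := hz k; simpa [hy, not_lt.2 hk] using this
  · refine hzt.1.congr' ?_
    filter_upwards [eventually_lt_atBot 0] with k hk
    simp [hy, hk]
  · refine hzt.2.congr' ?_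
    filter_upwards [eventually_ge_atTop 0] with k hk
    simp [hy, not_lt.2 hk]

theorem shad (f : X ≃ₜ X) (hL : LShadowing f) {ε : ℝ} (he : 0 < ε) :
    ∃ δ > 0, ∀ x : ℤ → X, (∀ k, dist (f (x k)) (x (k+1)) ≤ δ) →
      ∃ z, ∀ k, dist (iterZ f k z) (x k) ≤ ε := by
  obtain ⟨δ, hd, H⟩ := hL ε he
  refine ⟨δ, hd, fun x hx => ?_⟩
  have : ∀ n : ℕ, ∃ z, ∀ k : ℤ, -n ≤ k → k ≤ n → dist (iterZ f k z) (x k) ≤ ε := by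
    intro n
    set c : ℤ → ℤ := fun k => max (-n) (min n k) with hc
    set y : ℤ → X := fun k => iterZ f (k - c k) (x (c k)) with hy
    have hj : ∀ k : ℤ, (k < -n ∨ n ≤ k) → dist (f (y k)) (y (k+1)) = 0 := by
      intro k hk
      have : c (k+1) = c k := by simp only [hc]; omega
      simp only [hy, this, iterZ_succ]
      rw [show k - c k + 1 = k + 1 - c k by ring, dist_self]
    obtain ⟨z, hz, -⟩ := H y (by
      intro k
      by_cases hk : (k < -n ∨ n ≤ k)
      · rw [hj k hk]; exact hd.le
      · have h1 : c k = k := by simp only [hc]; omega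
        have h2 : c (k+1) = k+1 := by simp only [hc]; omega
        simp only [hy, h1, h2, sub_self, iterZ_zero]
        exact hx k) (by
      refine Tendsto.congr' ?_ tendsto_const_nhds
      have : {k : ℤ | (k < -n ∨ n ≤ k)} ∈ (cofinite : Filter ℤ) := by
        rw [mem_cofinite]
        refine (Set.finite_Icc (-(n:ℤ)) n).subset ?_
        intro k hk
        simp only [mem_compl_iff, mem_ofPred_eq] at hk
        simp only [mem_Icc]; omega
      filter_upwards [this] with k hk
      exact (hj k hk).symm)
    refine ⟨z, fun k h1 h2 => ?_⟩
    have := hz k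
    have h1 : c k = k := by simp only [hc]; omega
    simpa [hy, h1, iterZ_zero] using this
  choose z hz using this
  obtain ⟨w, -, φ, hφ, hw⟩ := isCompact_univ.tendsto_subseq (x := z) (fun _ => mem_univ _)
  refine ⟨w, fun k => ?_⟩
  have ht : Tendsto (fun n => dist (iterZ f k (z (φ n))) (x k)) atTop
      (nhds (dist (iterZ f k w) (x k))) :=
    (((iterZ_cont f k).tendsto w).comp hw).dist tendsto_const_nhds
  refine le_of_tendsto ht ?_
  filter_upwards [eventually_ge_atTop k.natAbs] with n hn
  have := hφ.id_le n
  simp only [id] at this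
  exact hz _ k (by omega) (by omega)

theorem tend_lt {L : Filter ℤ} {g : ℤ → ℝ} (h : Tendsto g L (nhds 0)) {η : ℝ} (he : 0 < η) :
    ∀ᶠ k in L, g k < η := h.eventually (gt_mem_nhds he)

theorem stp_orbs (f : X ≃ₜ X) {ε : ℝ} (he : 0 < ε) (p : X) (i j : ℤ) (hij : i ≤ j) :
    Relation.ReflTransGen (Stp f ε) (iterZ f i p) (iterZ f j p) :=
  orb_rtg (z := fun k => iterZ f k p) (fun k => stp_orb f he p k) i j hij

theorem near_class (f : X ≃ₜ X) (hL : LShadowing f) :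
    ∃ δ > 0, ∀ x a0 p : X, ∀ N : ℕ, 1 ≤ N → a0 ∈ chainClass f x →
      (∀ j : ℤ, dist (iterZ f (j * N) p) a0 ≤ δ) → p ∈ chainClass f x := by
  obtain ⟨δ, hd, H⟩ := link f hL one_pos
  refine ⟨δ, hd, fun x a0 p N hN ha hp => ?_⟩
  rw [mem_chainClass]
  intro η he
  constructor
  · obtain ⟨v, -, φ, hφ, hv⟩ := isCompact_univ.tendsto_subseq
      (x := fun n : ℕ => iterZ f ((-(n:ℤ)) * N) p) (fun _ => mem_univ _)
    have hva : dist a0 v ≤ δ := by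
      refine le_of_tendsto (tendsto_const_nhds.dist hv) (Eventually.of_forall fun n => ?_)
      rw [dist_comm]; exact hp _
    obtain ⟨z, -, -, z1, z2⟩ := H a0 v hva
    obtain ⟨k1, h1, h1'⟩ := ((tend_lt z1 he).and (eventually_lt_atBot 0)).exists
    obtain ⟨k2, h2, h2'⟩ := ((tend_lt z2 (half_pos he)).and (eventually_gt_atTop 0)).exists
    have hc : Tendsto (fun n => dist (iterZ f k2 (iterZ f ((-(φ n:ℤ)) * N) p)) (iterZ f k2 v))
        atTop (nhds 0) := by
      have := (((iterZ_cont f k2).tendsto v).comp hv).dist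
        (tendsto_const_nhds (x := iterZ f k2 v))
      simpa using this
    obtain ⟨n, hn, hn'⟩ := ((hc.eventually (gt_mem_nhds (half_pos he))).and
      (eventually_ge_atTop k2.natAbs)).exists
    rw [← iterZ_add] at hn
    have hm : k2 + (-(φ n:ℤ)) * N ≤ 0 := by
      have a1 : n ≤ φ n := hφ.id_le n
      have a2 : (φ n : ℤ) ≤ φ n * N := by
        have : φ n * 1 ≤ φ n * N := Nat.mul_le_mul_left _ hN
        exact_mod_cast (by simpa using this)
      have a3 : (-(φ n:ℤ)) * N = -((φ n:ℤ) * N) := by ring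
      omega
    have c1 := (((mem_chainClass f x _).1 (class_iter f ha (k1 - 1))) η he).1
    have c2 : Stp f η (iterZ f (k1 - 1) a0) (iterZ f k1 z) := by
      unfold Stp
      rw [iterZ_succ, sub_add_cancel, dist_comm]; exact h1
    have c3 := stp_orbs f he z k1 (k2 - 1) (by omega)
    have c4 : Stp f η (iterZ f (k2 - 1) z) (iterZ f (k2 + (-(φ n:ℤ)) * N) p) := by
      unfold Stp
      rw [iterZ_succ, sub_add_cancel]
      have := dist_triangle_right (iterZ f k2 z) (iterZ f (k2 + (-(φ n:ℤ)) * N) p) (iterZ f k2 v)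
      linarith
    have c5 := stp_orbs f he p _ _ hm
    rw [iterZ_zero] at c5
    exact ((((c1.tail c2).trans_left c3).tail c4).trans_left c5)
  · obtain ⟨v, -, φ, hφ, hv⟩ := isCompact_univ.tendsto_subseq
      (x := fun n : ℕ => iterZ f ((n:ℤ) * N) p) (fun _ => mem_univ _)
    have hva : dist v a0 ≤ δ := by
      refine le_of_tendsto (hv.dist tendsto_const_nhds) (Eventually.of_forall fun n => ?_)
      exact hp _
    obtain ⟨z, -, -, z1, z2⟩ := H v a0 hva
    obtain ⟨k1, h1, h1'⟩ := ((tend_lt z1 (half_pos he)).and (eventually_lt_atBot 0)).exists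
    obtain ⟨k2, h2, h2'⟩ := ((tend_lt z2 he).and (eventually_gt_atTop 0)).exists
    have hc : Tendsto (fun n => dist (iterZ f k1 (iterZ f ((φ n:ℤ) * N) p)) (iterZ f k1 v))
        atTop (nhds 0) := by
      have := (((iterZ_cont f k1).tendsto v).comp hv).dist
        (tendsto_const_nhds (x := iterZ f k1 v))
      simpa using this
    obtain ⟨n, hn, hn'⟩ := ((hc.eventually (gt_mem_nhds (half_pos he))).and
      (eventually_ge_atTop (k1.natAbs + 1))).exists
    rw [← iterZ_add] at hn
    have hm : 0 ≤ k1 + (φ n:ℤ) * N - 1 := by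
      have a1 : n ≤ φ n := hφ.id_le n
      have a2 : (φ n : ℤ) ≤ φ n * N := by
        have : φ n * 1 ≤ φ n * N := Nat.mul_le_mul_left _ hN
        exact_mod_cast (by simpa using this)
      omega
    have c1 := (((mem_chainClass f x _).1 (class_iter f ha k2)) η he).2
    have c2 : Stp f η (iterZ f (k2 - 1) z) (iterZ f k2 a0) := by
      unfold Stp
      rw [iterZ_succ, sub_add_cancel]; exact h2
    have c3 := stp_orbs f he z k1 (k2 - 1) (by omega)
    have c4 : Stp f η (iterZ f (k1 + (φ n:ℤ) * N - 1) p) (iterZ f k1 z) := by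
      unfold Stp
      rw [iterZ_succ, sub_add_cancel]
      have := dist_triangle_right (iterZ f (k1 + (φ n:ℤ) * N) p) (iterZ f k1 z) (iterZ f k1 v)
      linarith
    have c5 := stp_orbs f he p _ _ hm
    rw [iterZ_zero] at c5
    exact Relation.TransGen.trans_right c5
      (Relation.TransGen.head c4 (Relation.TransGen.trans_right c3 (c1.head c2)))

/-- one step of an `η`-chain of pairs at distance at most `e` -/
def PStp (f : X ≃ₜ X) (e η : ℝ) (u v : X × X) : Prop :=
  dist u.1 u.2 ≤ e ∧ dist v.1 v.2 ≤ e ∧ dist (f u.1) v.1 < η ∧ dist (f u.2) v.2 < η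

theorem pstp_diag (f : X ≃ₜ X) {e η : ℝ} (he : 0 < e) {u v : X}
    (h : Relation.TransGen (Stp f η) u v) :
    Relation.TransGen (PStp f e η) (u, u) (v, v) := by
  refine Relation.TransGen.lift (fun u => (u, u)) ?_ _ _ h
  intro a b hab
  exact ⟨by simpa using he.le, by simpa using he.le, hab, hab⟩

/-- one hop from the orbit pair `(a,b)` to the orbit pair `(c,d)` arriving at time `k` -/
theorem pstp_hop (f : X ≃ₜ X) {e η : ℝ} {a b c d : X} (k l : ℤ)
    (h1 : ∀ k, dist (iterZ f k a) (iterZ f k b) ≤ e)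
    (h2 : ∀ k, dist (iterZ f k c) (iterZ f k d) ≤ e)
    (h3 : dist (iterZ f k a) (iterZ f l c) < η) (h4 : dist (iterZ f k b) (iterZ f l d) < η) :
    PStp f e η (iterZ f (k-1) a, iterZ f (k-1) b) (iterZ f l c, iterZ f l d) := by
  refine ⟨h1 _, h2 _, ?_, ?_⟩ <;> simpa [iterZ_succ]

theorem pstp_orb (f : X ≃ₜ X) {e η : ℝ} (hη : 0 < η) {a b : X}
    (h1 : ∀ k, dist (iterZ f k a) (iterZ f k b) ≤ e) (i j : ℤ) (hij : i ≤ j) :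
    Relation.ReflTransGen (PStp f e η) (iterZ f i a, iterZ f i b) (iterZ f j a, iterZ f j b) := by
  refine orb_rtg (z := fun k => (iterZ f k a, iterZ f k b)) (fun k => ?_) i j hij
  exact ⟨h1 _, h1 _, by simp [iterZ_succ, hη], by simp [iterZ_succ, hη]⟩

theorem case_rec (f : X ≃ₜ X) {e δ : ℝ} (he : 0 < e)
    (H : ∀ a b : X, dist a b ≤ δ → ∃ z,
      (∀ k < 0, dist (iterZ f k z) (iterZ f k a) ≤ e/2) ∧
      (∀ k ≥ 0, dist (iterZ f k z) (iterZ f k b) ≤ e/2) ∧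
      Tendsto (fun k : ℤ => dist (iterZ f k z) (iterZ f k a)) atBot (nhds 0) ∧
      Tendsto (fun k : ℤ => dist (iterZ f k z) (iterZ f k b)) atTop (nhds 0))
    {x p q a b : X} (ha : a ∈ chainClass f x)
    (hab : ∀ k, dist (iterZ f k a) (iterZ f k b) ≤ e/2)
    (hpq : ∀ k, dist (iterZ f k p) (iterZ f k q) ≤ e/2)
    (hd : dist a b ≤ δ)
    (hrec : ∀ k l : ℤ, ∀ η > 0, ∃ m m' : ℤ, m < m' ∧
      dist (iterZ f m p) (iterZ f k a) < η ∧ dist (iterZ f m q) (iterZ f k b) < η ∧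
      dist (iterZ f m' p) (iterZ f l a) < η ∧ dist (iterZ f m' q) (iterZ f l b) < η)
    {η : ℝ} (hη : 0 < η) :
    ∃ c ∈ chainClass f x, ∃ c' ∈ chainClass f x,
      Relation.TransGen (PStp f e η) (c, c) (a, b) ∧
      Relation.TransGen (PStp f e η) (a, b) (c', c') := by
  have hab' : ∀ k, dist (iterZ f k a) (iterZ f k b) ≤ e := fun k => by linarith [hab k]
  have hpq' : ∀ k, dist (iterZ f k p) (iterZ f k q) ≤ e := fun k => by linarith [hpq k]
  have haa : ∀ k, dist (iterZ f k a) (iterZ f k a) ≤ e := fun k => by simpa using he.le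
  have R : ∀ k l : ℤ, Relation.TransGen (PStp f e η) (iterZ f k a, iterZ f k b)
      (iterZ f l a, iterZ f l b) := by
    intro k l
    obtain ⟨m, m', hm, r1, r2, r3, r4⟩ := hrec (k+1) l η hη
    have c1 := pstp_hop f (k+1) m hab' hpq' (by rwa [dist_comm]) (by rwa [dist_comm])
    rw [add_sub_cancel_right] at c1
    have c2 := pstp_orb f hη hpq' m (m'-1) (by omega)
    have c3 := pstp_hop f m' l hpq' hab' r3 r4
    exact (Relation.TransGen.head' c1 c2).tail c3
  obtain ⟨z, z1, z2, z3, z4⟩ := H a b hd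
  obtain ⟨w, w1, w2, w3, w4⟩ := H b a (by rwa [dist_comm])
  have haz : ∀ k, dist (iterZ f k a) (iterZ f k z) ≤ e := by
    intro k
    rcases lt_or_ge k 0 with h | h
    · rw [dist_comm]; linarith [z1 k h]
    · have := z2 k h
      linarith [hab k, dist_triangle_right (iterZ f k a) (iterZ f k z) (iterZ f k b)]
  have haw : ∀ k, dist (iterZ f k a) (iterZ f k w) ≤ e := by
    intro k
    rcases lt_or_ge k 0 with h | h
    · have := w1 k h
      linarith [hab k, dist_triangle_right (iterZ f k a) (iterZ f k w) (iterZ f k b)]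
    · rw [dist_comm]; linarith [w2 k h]
  obtain ⟨k1, h1, h1'⟩ := ((tend_lt z3 hη).and (eventually_lt_atBot 0)).exists
  obtain ⟨k2, h2, h2'⟩ := ((tend_lt z4 hη).and (eventually_gt_atTop 0)).exists
  obtain ⟨l1, g1, g1'⟩ := ((tend_lt w3 hη).and (eventually_lt_atBot 0)).exists
  obtain ⟨l2, g2, g2'⟩ := ((tend_lt w4 hη).and (eventually_gt_atTop 0)).exists
  refine ⟨iterZ f (k1-1) a, class_iter f ha _, iterZ f l2 a, class_iter f ha _, ?_, ?_⟩
  · have c1 := pstp_hop f (η := η) k1 k1 haa haz (by simpa using hη) (by rwa [dist_comm])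
    have c2 := pstp_orb f hη haz k1 (k2-1) (by omega)
    have c3 := pstp_hop f (η := η) k2 k2 haz hab' (by simpa using hη) h2
    have c4 := R k2 0
    rw [iterZ_zero, iterZ_zero] at c4
    exact ((Relation.TransGen.head' c1 c2).tail c3).trans c4
  · have c1 := pstp_hop f (η := η) l1 l1 hab' haw (by simpa using hη) (by rwa [dist_comm])
    have c2 := pstp_orb f hη haw l1 (l2-1) (by omega)
    have c3 := pstp_hop f (η := η) l2 l2 haw haa (by simpa using hη) g2
    have c4 := R 0 (l1-1)
    rw [iterZ_zero, iterZ_zero] at c4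
    exact c4.trans ((Relation.TransGen.head' c1 c2).tail c3)

theorem clus (f : X ≃ₜ X) {L : Filter ℤ} [L.IsCountablyGenerated] {p q : X}
    (h : ¬ Tendsto (fun k : ℤ => dist (iterZ f k p) (iterZ f k q)) L (nhds 0)) :
    ∃ (a b : X) (ks : ℕ → ℤ), a ≠ b ∧ Tendsto ks atTop L ∧
      ∀ k : ℤ, Tendsto (fun n => iterZ f (ks n + k) p) atTop (nhds (iterZ f k a)) ∧
        Tendsto (fun n => iterZ f (ks n + k) q) atTop (nhds (iterZ f k b)) := by
  rw [Metric.tendsto_nhds] at h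
  push Not at h
  obtain ⟨r, hr, hf⟩ := h
  obtain ⟨ns, hns, hns'⟩ := exists_seq_forall_of_frequently hf
  obtain ⟨⟨a, b⟩, -, φ, hφ, hv⟩ := isCompact_univ.tendsto_subseq
      (x := fun n : ℕ => (iterZ f (ns n) p, iterZ f (ns n) q)) (fun _ => mem_univ _)
  have v1 : Tendsto (fun n => iterZ f (ns (φ n)) p) atTop (nhds a) :=
    (continuous_fst.tendsto _).comp hv
  have v2 : Tendsto (fun n => iterZ f (ns (φ n)) q) atTop (nhds b) :=
    (continuous_snd.tendsto _).comp hv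
  refine ⟨a, b, fun n => ns (φ n), ?_, hns.comp hφ.tendsto_atTop, fun k => ⟨?_, ?_⟩⟩
  · have : r ≤ dist a b := by
      refine ge_of_tendsto (v1.dist v2) (Eventually.of_forall fun n => ?_)
      have := hns' (φ n)
      simpa using this
    intro hab
    rw [hab, dist_self] at this; linarith
  · have := ((iterZ_cont f k).tendsto a).comp v1
    refine this.congr fun n => ?_
    simp only [Function.comp]; rw [← iterZ_add, add_comm]
  · have := ((iterZ_cont f k).tendsto b).comp v2
    refine this.congr fun n => ?_
    simp only [Function.comp]; rw [← iterZ_add, add_comm]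

theorem loops (f : X ≃ₜ X) (hL : LShadowing f) (x : X) (hne : ¬ ExpansiveOn f (chainClass f x))
    {e : ℝ} (he : 0 < e) :
    ∃ a b : X, a ≠ b ∧ ∀ η > 0, ∃ c ∈ chainClass f x, ∃ c' ∈ chainClass f x,
      Relation.TransGen (PStp f e η) (c, c) (a, b) ∧
      Relation.TransGen (PStp f e η) (a, b) (c', c') := by
  obtain ⟨δ, hδ, H⟩ := link f hL (half_pos he)
  unfold ExpansiveOn at hne
  push Not at hne
  obtain ⟨p, hp, q, hq, hpq, hpqne⟩ := hne (min δ (e/2)) (by positivity)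
  have hpq1 : ∀ k, dist (iterZ f k p) (iterZ f k q) ≤ e/2 :=
    fun k => (hpq k).trans (min_le_right _ _)
  -- properties inherited by limits
  have inh : ∀ (L : Filter ℤ) (a b : X) (ks : ℕ → ℤ), Tendsto ks atTop L →
      (∀ k : ℤ, Tendsto (fun n => iterZ f (ks n + k) p) atTop (nhds (iterZ f k a)) ∧
        Tendsto (fun n => iterZ f (ks n + k) q) atTop (nhds (iterZ f k b))) →
      a ∈ chainClass f x ∧ (∀ k, dist (iterZ f k a) (iterZ f k b) ≤ e/2) ∧ dist a b ≤ δ ∧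
      ∀ k : ℤ, ∀ η > 0, ∀ᶠ n in atTop, dist (iterZ f (ks n + k) p) (iterZ f k a) < η ∧
        dist (iterZ f (ks n + k) q) (iterZ f k b) < η := by
    intro L a b ks hks hk
    have hD : ∀ k, dist (iterZ f k a) (iterZ f k b) ≤ min δ (e/2) := fun k =>
      le_of_tendsto ((hk k).1.dist (hk k).2) (Eventually.of_forall fun n => hpq _)
    refine ⟨?_, fun k => (hD k).trans (min_le_right _ _), ?_, ?_⟩
    · have := (class_closed f x).mem_of_tendsto (hk 0).1
        (Eventually.of_forall fun n => class_iter f hp _)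
      rwa [iterZ_zero] at this
    · have := (hD 0).trans (min_le_left _ _)
      rwa [iterZ_zero, iterZ_zero] at this
    · intro k η hη
      exact ((Metric.tendsto_nhds.1 (hk k).1) η hη).and ((Metric.tendsto_nhds.1 (hk k).2) η hη)
  by_cases hT : Tendsto (fun k : ℤ => dist (iterZ f k p) (iterZ f k q)) atTop (nhds 0)
  swap
  · obtain ⟨a, b, ks, hne, hks, hk⟩ := clus f hT
    obtain ⟨i1, i2, i3, i4⟩ := inh _ a b ks hks hk
    refine ⟨a, b, hne, fun η hη => case_rec f he H i1 i2 hpq1 i3 ?_ hη⟩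
    intro k l η hη
    obtain ⟨n, n1, n2⟩ := (i4 k η hη).exists
    obtain ⟨n', ⟨n3, n4⟩, n5⟩ := ((i4 l η hη).and
      (hks.eventually (eventually_gt_atTop (ks n + k - l)))).exists
    exact ⟨ks n + k, ks n' + l, by omega, n1, n2, n3, n4⟩
  by_cases hB : Tendsto (fun k : ℤ => dist (iterZ f k p) (iterZ f k q)) atBot (nhds 0)
  swap
  · obtain ⟨a, b, ks, hne, hks, hk⟩ := clus f hB
    obtain ⟨i1, i2, i3, i4⟩ := inh _ a b ks hks hk
    refine ⟨a, b, hne, fun η hη => case_rec f he H i1 i2 hpq1 i3 ?_ hη⟩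
    intro k l η hη
    obtain ⟨n', n3, n4⟩ := (i4 l η hη).exists
    obtain ⟨n, ⟨n1, n2⟩, n5⟩ := ((i4 k η hη).and
      (hks.eventually (eventually_lt_atBot (ks n' + l - k)))).exists
    exact ⟨ks n + k, ks n' + l, by omega, n1, n2, n3, n4⟩
  refine ⟨p, q, hpqne, fun η hη => ?_⟩
  have hpq' : ∀ k, dist (iterZ f k p) (iterZ f k q) ≤ e := fun k => by linarith [hpq1 k]
  have hpp : ∀ k, dist (iterZ f k p) (iterZ f k p) ≤ e := fun k => by simpa using he.le
  obtain ⟨k1, h1, h1'⟩ := ((tend_lt hB hη).and (eventually_lt_atBot 0)).exists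
  obtain ⟨k2, h2, h2'⟩ := ((tend_lt hT hη).and (eventually_gt_atTop 0)).exists
  refine ⟨iterZ f (k1-1) p, class_iter f hp _, iterZ f k2 p, class_iter f hp _, ?_, ?_⟩
  · have c1 := pstp_hop f (η := η) k1 k1 hpp hpq' (by simpa using hη) h1
    have c2 := pstp_orb f hη hpq' k1 0 (by omega)
    rw [iterZ_zero, iterZ_zero] at c2
    exact Relation.TransGen.head' c1 c2
  · have c2 := pstp_orb f hη hpq' 0 (k2-1) (by omega)
    rw [iterZ_zero, iterZ_zero] at c2
    have c3 := pstp_hop f (η := η) k2 k2 hpq' hpp (by simpa using hη) (by rwa [dist_comm])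
    exact Relation.TransGen.tail' c2 c3

/-- the pseudo-orbit coded by `s` -/
def cod (A B : ℕ → X) (N : ℕ) (s : ℤ → Bool) (k : ℤ) : X :=
  if s (k / N) then B (k % N).toNat else A (k % N).toNat

theorem cod_shift (A B : ℕ → X) {N : ℕ} (hN : 0 < N) (s : ℤ → Bool) (j k : ℤ) :
    cod A B N (fun i => s (i + j)) k = cod A B N s (k + j * N) := by
  have : (N : ℤ) ≠ 0 := by omega
  simp [cod, Int.add_mul_ediv_right _ _ this]

theorem cod_jump (f : X ≃ₜ X) {A B : ℕ → X} {N : ℕ} (hN : 0 < N) {η : ℝ}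
    (hA : ∀ i < N, dist (f (A i)) (A (i+1)) < η) (hB : ∀ i < N, dist (f (B i)) (B (i+1)) < η)
    (h1 : B 0 = A 0) (h2 : A N = A 0) (h3 : B N = A 0) (s : ℤ → Bool) (k : ℤ) :
    dist (f (cod A B N s k)) (cod A B N s (k+1)) ≤ η := by
  have hN' : (0:ℤ) < N := by omega
  obtain ⟨j, i, hi, rfl⟩ : ∃ (j : ℤ) (i : ℕ), i < N ∧ k = i + j * N := by
    refine ⟨k / N, (k % N).toNat, ?_, ?_⟩
    · have := Int.emod_lt_of_pos k hN'
      have := Int.emod_nonneg k hN'.ne'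
      omega
    · have := Int.emod_nonneg k hN'.ne'
      rw [Int.toNat_of_nonneg this]
      have := Int.emod_add_mul_ediv k N
      linarith
  have e1 : ∀ i < N, ∀ s : ℤ → Bool, cod A B N s i = if s 0 then B i else A i := by
    intro i hi s
    have a1 : (i : ℤ) / N = 0 := Int.ediv_eq_zero_of_lt (by omega) (by omega)
    have a2 : (i : ℤ) % N = i := Int.emod_eq_of_lt (by omega) (by omega)
    simp [cod, a1, a2]
  have e2 : ∀ s : ℤ → Bool, cod A B N s N = A 0 := by
    intro s
    simp [cod, hN'.ne', h1]
  rw [show (i:ℤ) + j * N + 1 = ((i+1 : ℕ) : ℤ) + j * N by push_cast; ring,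
    ← cod_shift A B hN, ← cod_shift A B hN, e1 i hi]
  have e3 : cod A B N (fun i => s (i + j)) ((i+1 : ℕ) : ℤ) = if s (0 + j) then B (i+1) else A (i+1) := by
    by_cases h : i + 1 < N
    · rw [e1 _ h]
    · obtain h : i + 1 = N := by omega
      rw [h, e2, h2, h3]; simp
  rw [e3]
  split_ifs
  · exact (hB i hi).le
  · exact (hA i hi).le

theorem horse (f : X ≃ₜ X) (hL : LShadowing f) (x : X)
    (hne : ¬ ExpansiveOn f (chainClass f x)) : SmallHorseshoes f (chainClass f x) := by
  intro ε hε
  obtain ⟨a, b, hab, hloop⟩ := loops f hL x hne (half_pos hε)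
  obtain ⟨δ0, hδ0, hnear⟩ := near_class f hL
  have hr : 0 < dist a b := dist_pos.2 hab
  set e := min (min (ε/8) (dist a b / 4)) δ0 with hedef
  have he : 0 < e := by positivity
  have he1 : e ≤ ε/8 := (min_le_left _ _).trans (min_le_left _ _)
  have he2 : e ≤ dist a b / 4 := (min_le_left _ _).trans (min_le_right _ _)
  have he3 : e ≤ δ0 := min_le_right _ _
  obtain ⟨η, hη, hshad⟩ := shad f hL he
  obtain ⟨c, hc, c', hc', t1, t2⟩ := hloop η hη
  obtain ⟨N, z, i0, hi0, z0, zN, zi, hz⟩ :=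
    tg_loop t1 (t2.trans (pstp_diag f (half_pos hε) (class_trans f hc' hc hη)))
  set A : ℕ → X := fun i => (z i).1 with hA
  set B : ℕ → X := fun i => (z i).2 with hB
  have hN : 0 < N := by omega
  have hNz : (N : ℤ) ≠ 0 := by omega
  have A0 : A 0 = c := by simp [hA, z0]
  have B0 : B 0 = c := by simp [hB, z0]
  have AN : A N = c := by simp [hA, zN]
  have BN : B N = c := by simp [hB, zN]
  have Ai : A i0 = a := by simp [hA, zi]
  have Bi : B i0 = b := by simp [hB, zi]
  have hclose : ∀ i < N, dist (A i) (B i) ≤ ε/2 := fun i hi => (hz i hi).1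
  have hjump := cod_jump f hN (η := η) (A := A) (B := B) (fun i hi => (hz i hi).2.2.1)
    (fun i hi => (hz i hi).2.2.2) (B0.trans A0.symm) (AN.trans A0.symm) (BN.trans A0.symm)
  set K : Set X := {p | ∃ s : ℤ → Bool, ∀ k, dist (iterZ f k p) (cod A B N s k) ≤ e} with hK
  have memK : ∀ p, p ∈ K ↔ ∃ s : ℤ → Bool, ∀ k, dist (iterZ f k p) (cod A B N s k) ≤ e :=
    fun p => Iff.rfl
  have codi : ∀ s : ℤ → Bool, ∀ j : ℤ, cod A B N s (j * N + i0) = if s j then b else a := by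
    intro s j
    have a1 : (i0 : ℤ) / N = 0 := Int.ediv_eq_zero_of_lt (by omega) (by omega)
    have a2 : (i0 : ℤ) % N = i0 := Int.emod_eq_of_lt (by omega) (by omega)
    rw [add_comm]
    simp [cod, Int.add_mul_ediv_right _ _ hNz, a1, a2, Ai, Bi]
  have codc : ∀ s : ℤ → Bool, ∀ j : ℤ, cod A B N s (j * N) = c := by
    intro s j
    simp [cod, hNz, A0, B0]
  have Kshift : ∀ p ∈ K, ∀ j : ℤ, iterZ f (j * N) p ∈ K := by
    rintro p ⟨s, hs⟩ j
    refine ⟨fun i => s (i + j), fun k => ?_⟩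
    rw [cod_shift A B hN, ← iterZ_add]
    exact hs _
  refine ⟨N, hN, K, ?_, ?_, ?_, ?_, fun p j => decide (dist (iterZ f (j * N + i0) p) b < dist a b / 2),
    ?_, ?_, ?_⟩
  · rintro p ⟨s, hs⟩
    refine hnear x c p N hN hc fun j => ?_
    have := hs (j * N)
    rw [codc] at this
    exact this.trans he3
  · have hcl : IsClosed {w : X × (ℤ → Bool) | ∀ k, dist (iterZ f k w.1) (cod A B N w.2 k) ≤ e} := by
      simp only [ofPred_forall]
      refine isClosed_iInter fun k => ?_
      refine isClosed_le (Continuous.dist ((iterZ_cont f k).comp continuous_fst) ?_)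
        continuous_const
      have : Continuous (fun t : Bool => if t then B (k % N).toNat else A (k % N).toNat) :=
        continuous_of_discreteTopology
      exact this.comp ((continuous_apply (k / N)).comp continuous_snd)
    have := hcl.isCompact.image continuous_fst
    convert this using 1
    ext p
    rw [memK]
    constructor
    · rintro ⟨s, hs⟩; exact ⟨(p, s), hs, rfl⟩
    · rintro ⟨⟨p', s⟩, hs, rfl⟩; exact ⟨s, hs⟩
  · apply Subset.antisymm
    · rintro _ ⟨p, hp, rfl⟩
      have := Kshift p hp 1
      rwa [one_mul, iterZ_natCast] at this
    · intro p hp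
      refine ⟨iterZ f (-1 * N) p, Kshift p hp (-1), ?_⟩
      rw [← iterZ_natCast, ← iterZ_add]
      simp [iterZ_zero]
  · intro k
    refine Metric.diam_le_of_forall_dist_le hε.le ?_
    rintro _ ⟨p, ⟨s, hs⟩, rfl⟩ _ ⟨q, ⟨t, ht⟩, rfl⟩
    have h1 := hs k
    have h2 := ht k
    have hi : (k % N).toNat < N := by
      have := Int.emod_lt_of_pos k (show (0:ℤ) < N by omega)
      omega
    have h3 : dist (cod A B N s k) (cod A B N t k) ≤ ε/2 := by
      have := hclose _ hi
      have h0 : (0:ℝ) ≤ ε/2 := by positivity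
      unfold cod
      split_ifs
      · simpa using h0
      · rwa [dist_comm]
      · exact this
      · simpa using h0
    have h4 := dist_triangle4 (iterZ f k p) (cod A B N s k) (cod A B N t k) (iterZ f k q)
    rw [dist_comm (cod A B N t k)] at h4
    linarith
  · rw [continuousOn_pi]
    intro j p hp
    have hg : Continuous fun p => dist (iterZ f (j * N + i0) p) b :=
      (iterZ_cont f _).dist continuous_const
    refine ContinuousWithinAt.congr_of_eventuallyEq (continuousWithinAt_const
      (b := decide (dist (iterZ f (j * N + i0) p) b < dist a b / 2))) ?_ rfl
    by_cases h : dist (iterZ f (j * N + i0) p) b < dist a b / 2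
    · have := (hg.tendsto p).eventually (gt_mem_nhds h)
      filter_upwards [mem_nhdsWithin_of_mem_nhds this] with p' hp'
      simp [h, hp']
    · have h' : dist a b / 2 < dist (iterZ f (j * N + i0) p) b := by
        obtain ⟨s, hs⟩ := hp
        have h1 := hs (j * N + i0)
        rw [codi] at h1
        split_ifs at h1
        · exact absurd (by linarith) h
        · have := dist_triangle_left a b (iterZ f (j * N + i0) p)
          linarith
      have := (hg.tendsto p).eventually (lt_mem_nhds h')
      filter_upwards [mem_nhdsWithin_of_mem_nhds this] with p' hp'
      simp [h, not_lt.2 hp'.le]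
  · intro s
    obtain ⟨p, hp⟩ := hshad (cod A B N s) (hjump s)
    refine ⟨p, ⟨s, hp⟩, ?_⟩
    funext j
    have h1 := hp (j * N + i0)
    rw [codi] at h1
    cases hsj : s j
    · simp only [hsj, Bool.false_eq_true, if_false] at h1
      have := dist_triangle_left a b (iterZ f (j * N + i0) p)
      simp only [decide_eq_false_iff_not, not_lt]
      linarith
    · simp only [hsj, if_true] at h1
      simp only [decide_eq_true_eq]
      linarith
  · intro p _
    funext j
    have : iterZ f (j * N + i0) ((⇑f)^[N] p) = iterZ f ((j + 1) * N + i0) p := by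
      rw [← iterZ_natCast, ← iterZ_add]
      congr 1
      ring
    simp only [this]

end helpers

/-- each chain recurrent class is expansive or contains arbitrarily
small topological semi-horseshoes. -/
theorem chainClass_expansive_or_horseshoes [CompactSpace X] (f : X ≃ₜ X)
    (hL : LShadowing f) :
    ∀ x : X, ExpansiveOn f (chainClass f x) ∨ SmallHorseshoes f (chainClass f x) := by
  intro x
  exact or_iff_not_imp_left.2 (horse f hL x)
end

section
/- If a homeomorphism f of a compact metric space has the L-shadowing property and its non-wandering set Ω(f) is entropy-expansive (or countably-expansive), then Ω(f) is expansive. -/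
open Filter Metric Set Topology

variable {X : Type*} [MetricSpace X]

namespace LSh

set_option linter.unusedVariables false

open Relation

lemma zpow_add_apply (f : X ≃ₜ X) (k l : ℤ) (x : X) : (f ^ (k + l)) x = (f ^ k) ((f ^ l) x) := by
  rw [zpow_add]; rfl

lemma zpow_succ_apply (f : X ≃ₜ X) (k : ℤ) (x : X) : (f ^ (k + 1)) x = f ((f ^ k) x) := by
  rw [add_comm, zpow_add_apply, zpow_one]

lemma pow_apply (f : X ≃ₜ X) (n : ℕ) (x : X) : (f ^ n) x = (⇑f)^[n] x := by
  induction n generalizing x with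
  | zero => rfl
  | succ n ih => rw [pow_succ, Function.iterate_succ_apply, ← ih]; rfl

lemma iterZ_eq (f : X ≃ₜ X) (k : ℤ) (x : X) : iterZ f k x = (f ^ k) x := by
  unfold iterZ
  split_ifs with h
  · obtain ⟨n, rfl⟩ := Int.eq_ofNat_of_zero_le h
    simp [← pow_apply]
  · obtain ⟨n, hn⟩ := Int.eq_ofNat_of_zero_le (a := -k) (by omega)
    obtain rfl : k = -(n : ℤ) := by omega
    rw [zpow_neg, zpow_natCast, ← inv_pow, pow_apply]
    simp only [neg_neg, Int.toNat_natCast]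
    rfl

/-- One step of an `η`-chain of tuples of diameter at most `δ`. -/
def Step {ι : Type} (f : X ≃ₜ X) (δ η : ℝ) (u v : ι → X) : Prop :=
  (∀ i j, dist (u i) (u j) ≤ δ) ∧ (∀ i j, dist (v i) (v j) ≤ δ) ∧ ∀ i, dist (f (u i)) (v i) ≤ η

/-- iterate of tuple -/
def it {ι : Type} (f : X ≃ₜ X) (k : ℤ) (u : ι → X) : ι → X := fun i => (f ^ k) (u i)

/-- orbit stays `δ`-small -/
def Small {ι : Type} (f : X ≃ₜ X) (δ : ℝ) (u : ι → X) : Prop :=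
  ∀ (k : ℤ) i j, dist ((f ^ k) (u i)) ((f ^ k) (u j)) ≤ δ

variable {ι κ : Type} {f : X ≃ₜ X} {δ η : ℝ}

lemma Step.mono {δ' η' : ℝ} (hd : δ ≤ δ') (he : η ≤ η') {u v : ι → X} (h : Step f δ η u v) :
    Step f δ' η' u v :=
  ⟨fun i j => (h.1 i j).trans hd, fun i j => (h.2.1 i j).trans hd, fun i => (h.2.2 i).trans he⟩

lemma chain_mono {δ' η' : ℝ} (hd : δ ≤ δ') (he : η ≤ η') {u v : ι → X}
    (h : TransGen (Step f δ η) u v) : TransGen (Step f δ' η') u v :=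
  TransGen.mono (fun _ _ (h : Step f δ η _ _) => h.mono hd he) _ _ h

lemma rchain_mono {δ' η' : ℝ} (hd : δ ≤ δ') (he : η ≤ η') {u v : ι → X}
    (h : ReflTransGen (Step f δ η) u v) : ReflTransGen (Step f δ' η') u v :=
  ReflTransGen.mono (fun _ _ (h : Step f δ η _ _) => h.mono hd he) _ _ h

lemma chain_lift (φ : κ → ι) {u v : ι → X}
    (h : TransGen (Step f δ η) u v) : TransGen (Step f δ η) (u ∘ φ) (v ∘ φ) :=
  TransGen.lift (fun u : ι → X => u ∘ φ)
    (fun _ _ (h : Step f δ η _ _) =>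
      (⟨fun i j => h.1 _ _, fun i j => h.2.1 _ _, fun i => h.2.2 _⟩ : Step f δ η _ _)) _ _ h

lemma it_zero (u : ι → X) : it f 0 u = u := by
  funext i; simp [it]

lemma it_add (k l : ℤ) (u : ι → X) : it f (k + l) u = it f k (it f l u) := by
  funext i; simp [it, zpow_add_apply]

lemma Small.it {u : ι → X} (h : Small f δ u) (k : ℤ) : Small f δ (it f k u) := by
  intro l i j
  have := h (l + k) i j
  rwa [zpow_add_apply, zpow_add_apply] at this

lemma Small.base {u : ι → X} (h : Small f δ u) (i j : ι) : dist (u i) (u j) ≤ δ := h 0 i j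

lemma Small.step (hη : 0 ≤ η) {u : ι → X} (h : Small f δ u) (k : ℤ) :
    Step f δ η (LSh.it f k u) (LSh.it f (k + 1) u) := by
  refine ⟨(h.it k).base, (h.it _).base, fun i => ?_⟩
  simp [LSh.it, zpow_succ_apply, hη]

lemma Small.orbit (hη : 0 ≤ η) {u : ι → X} (h : Small f δ u) {k l : ℤ} (hkl : k < l) :
    TransGen (Step f δ η) (LSh.it f k u) (LSh.it f l u) := by
  obtain ⟨n, hn⟩ := Int.eq_ofNat_of_zero_le (a := l - k - 1) (by omega)
  obtain rfl : l = k + n + 1 := by omega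
  clear hn hkl
  induction n with
  | zero => simpa using TransGen.single (h.step hη k)
  | succ n ih =>
    have := ih.tail (h.step hη (k + n + 1))
    push_cast
    convert this using 2
    ring

lemma Small.rorbit (hη : 0 ≤ η) {u : ι → X} (h : Small f δ u) {k l : ℤ} (hkl : k ≤ l) :
    ReflTransGen (Step f δ η) (LSh.it f k u) (LSh.it f l u) := by
  rcases hkl.eq_or_lt with rfl | h'
  · exact ReflTransGen.refl
  · exact (h.orbit hη h').to_reflTransGen

lemma chain_back [CompactSpace X] {q : ι → X} (hq : Small f δ q)
    (h : ∀ η > 0, TransGen (Step f δ η) q q) (hη : 0 < η) :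
    TransGen (Step f δ η) q (it f (-1) q) := by
  have huc : UniformContinuous f.symm := CompactSpace.uniformContinuous_of_continuous f.symm.continuous
  obtain ⟨e, he, H⟩ := Metric.uniformContinuous_iff.1 huc (η / 2) (half_pos hη)
  set e' := min (e / 2) (η / 2) with he'
  have hpos : 0 < e' := lt_min (half_pos he) (half_pos hη)
  have hl := h e' hpos
  obtain ⟨p, hp1, hp2⟩ := TransGen.tail'_iff.1 hl
  obtain ⟨p', hp1', hp2'⟩ := TransGen.tail'_iff.1 (hl.trans_left hp1)
  have hle : e' ≤ η := (min_le_right _ _).trans (by linarith)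
  refine TransGen.tail'_iff.2 ⟨p', rchain_mono le_rfl hle hp1', hp2'.1, (hq.it (-1)).base, fun i => ?_⟩
  have h1 := hp2'.2.2 i
  have h2 : dist (f.symm (f (p i))) (f.symm (q i)) < η / 2 :=
    H (lt_of_le_of_lt (hp2.2.2 i) ((min_le_left _ _).trans_lt (by linarith)))
  rw [f.symm_apply_apply] at h2
  have h3 : it f (-1) q i = f.symm (q i) := by simp [it]
  rw [h3]
  have := dist_triangle (f (p' i)) (p i) (f.symm (q i))
  have := min_le_right (e / 2) (η / 2)
  linarith

lemma chain_fwd [CompactSpace X] {q : ι → X} (hq : Small f δ q)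
    (h : ∀ η > 0, TransGen (Step f δ η) q q) (hη : 0 < η) :
    TransGen (Step f δ η) (it f 1 q) q := by
  have huc : UniformContinuous f := CompactSpace.uniformContinuous_of_continuous f.continuous
  obtain ⟨e, he, H⟩ := Metric.uniformContinuous_iff.1 huc (η / 2) (half_pos hη)
  set e' := min (e / 2) (η / 2) with he'
  have hpos : 0 < e' := lt_min (half_pos he) (half_pos hη)
  have hl := h e' hpos
  obtain ⟨p, hp1, hp2⟩ := TransGen.head'_iff.1 hl
  obtain ⟨p', hp1', hp2'⟩ := TransGen.head'_iff.1 (TransGen.trans_right hp2 hl)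
  have hle : e' ≤ η := (min_le_right _ _).trans (by linarith)
  refine TransGen.head'_iff.2 ⟨p', ⟨(hq.it 1).base, hp1'.2.1, fun i => ?_⟩, rchain_mono le_rfl hle hp2'⟩
  have h1 := hp1'.2.2 i
  have h2 : dist (f (f (q i))) (f (p i)) < η / 2 :=
    H (lt_of_le_of_lt (hp1.2.2 i) ((min_le_left _ _).trans_lt (by linarith)))
  have h3 : it f 1 q i = f (q i) := by simp [it]
  rw [h3]
  have := dist_triangle (f (f (q i))) (f (p i)) (p' i)
  have := min_le_right (e / 2) (η / 2)
  linarith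

lemma chain_all [CompactSpace X] {q : ι → X} (hq : Small f δ q)
    (h : ∀ η > 0, TransGen (Step f δ η) q q) (i j : ℤ) (hη : 0 < η) :
    TransGen (Step f δ η) (it f i q) (it f j q) := by
  have P : ∀ k : ℤ, ∀ η > 0, TransGen (Step f δ η) (it f k q) (it f k q) := by
    intro k
    induction k using Int.induction_on with
    | zero => simpa [it_zero] using h
    | succ k ih =>
      intro η hη
      have h1 := chain_fwd (hq.it k) ih hη
      rw [← it_add, add_comm] at h1
      exact h1.trans (hq.orbit hη.le (by omega))
    | pred k ih =>
      intro η hη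
      have h1 := chain_back (hq.it (-k)) ih hη
      rw [← it_add] at h1
      rw [show (-(k : ℤ) - 1) = -1 + -k by ring]
      exact (hq.orbit hη.le (by omega)).trans h1
  induction j using Int.inductionOn' (b := i) with
  | zero => exact P i η hη
  | succ k _ ih => exact ih.trans (hq.orbit hη.le (by omega))
  | pred k _ ih =>
    have h1 := chain_back (hq.it k) (P k) hη
    rw [← it_add] at h1
    rw [show k - 1 = -1 + k by ring]
    exact ih.trans h1

/-- Points recurrent along an orbit are chain recurrent. -/
lemma chain_of_recur {q u : ι → X} (hu : Small f δ u) (hq : Small f δ q)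
    (h : ∀ e > 0, ∃ k l : ℤ, k + 2 ≤ l ∧ (∀ i, dist (f ((f ^ k) (u i))) (f (q i)) ≤ e) ∧
      ∀ i, dist ((f ^ l) (u i)) (q i) ≤ e) (hη : 0 < η) :
    TransGen (Step f δ η) q q := by
  obtain ⟨k, l, hkl, h1, h2⟩ := h η hη
  have s1 : Step f δ η q (it f (k + 1) u) := by
    refine ⟨hq.base, (hu.it _).base, fun i => ?_⟩
    rw [dist_comm]
    simpa [it, zpow_succ_apply] using h1 i
  have s2 : Step f δ η (it f (l - 1) u) q := by
    refine ⟨(hu.it _).base, hq.base, fun i => ?_⟩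
    have := h2 i
    rw [← sub_add_cancel l 1, zpow_succ_apply] at this
    simpa [it] using this
  exact TransGen.head' s1 ((hu.rorbit hη.le (by omega)).tail s2)

lemma chain_of_nonwandering {x : X} (hδ : 0 ≤ δ) (hx : NonWandering f x) (hη : 0 < η) :
    TransGen (Step f δ η) (fun _ : Unit => x) (fun _ : Unit => x) := by
  have hS : ∀ u : Unit → X, Small f δ u := fun u k i j => by simpa using hδ
  obtain ⟨e, he, H⟩ := Metric.continuousAt_iff.1 (f.continuous.continuousAt (x := x)) (η / 2) (half_pos hη)
  obtain ⟨k, hk, y, ⟨u, hu, rfl⟩, hy⟩ := hx (ball x (min e (η / 2))) isOpen_ball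
    (mem_ball_self (lt_min he (half_pos hη)))
  simp only [mem_ball, lt_min_iff] at hu hy
  have h1 := H hu.1
  rw [dist_comm] at h1
  obtain ⟨n, rfl⟩ : ∃ n, k = n + 1 := ⟨k - 1, by omega⟩
  rcases n with _ | n
  · refine TransGen.single ⟨by simpa using hδ, by simpa using hδ, fun _ => ?_⟩
    simp only [zero_add, Function.iterate_one] at hy
    have := dist_triangle (f x) (f u) x
    linarith [hy.2]
  · have s1 : Step f δ η (fun _ : Unit => x) (it f 1 (fun _ : Unit => u)) := by
      refine ⟨(hS _).base, (hS _).base, fun i => ?_⟩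
      simp only [it, zpow_one]; linarith
    have s2 : Step f δ η (it f ((n + 1 : ℕ) : ℤ) (fun _ : Unit => u)) (fun _ : Unit => x) := by
      refine ⟨(hS _).base, (hS _).base, fun i => ?_⟩
      have := hy.2
      rw [Function.iterate_succ_apply', ← pow_apply] at this
      simp only [it, zpow_natCast]; linarith
    exact TransGen.head' s1 (((hS _).rorbit hη.le (by push_cast; omega)).tail s2)

lemma isClosed_small : IsClosed {v : ι → X | Small f δ v} := by
  have : {v : ι → X | Small f δ v} =
      ⋂ k : ℤ, ⋂ i, ⋂ j, {v : ι → X | dist ((f ^ k) (v i)) ((f ^ k) (v j)) ≤ δ} := by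
    ext v; simp [Small]
  rw [this]
  refine isClosed_iInter fun k => isClosed_iInter fun i => isClosed_iInter fun j => ?_
  refine isClosed_le ?_ continuous_const
  exact ((f ^ k).continuous.comp (continuous_apply i)).dist
    ((f ^ k).continuous.comp (continuous_apply j))

lemma exists_pair_of_not_tendsto [CompactSpace X] {u : Bool → X} (hu : Small f δ u)
    (l : Filter ℤ)
    (hl : ∀ S : Set ℤ, (∃ᶠ k in l, k ∈ S) → ∃ k ∈ S, ∃ m ∈ S, k + 2 ≤ m)
    (h : ¬ Tendsto (fun k : ℤ => dist ((f ^ k) (u true)) ((f ^ k) (u false))) l (𝓝 0)) :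
    ∃ q : Bool → X, Small f δ q ∧ q true ≠ q false ∧ ∀ η > 0, TransGen (Step f δ η) q q := by
  rw [Metric.tendsto_nhds] at h
  push Not at h
  obtain ⟨e, he, h⟩ := h
  have hK : IsCompact ({v : Bool → X | Small f δ v} ∩ {v | e ≤ dist (v true) (v false)}) := by
    apply IsClosed.isCompact
    refine isClosed_small.inter (isClosed_le continuous_const ?_)
    exact (continuous_apply _).dist (continuous_apply _)
  have hf : ∃ᶠ k in l, it f k u ∈
      ({v : Bool → X | Small f δ v} ∩ {v | e ≤ dist (v true) (v false)}) := by
    refine h.mono fun k hk => ⟨hu.it k, ?_⟩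
    simpa [it, Real.dist_eq] using hk
  obtain ⟨q, ⟨hq1, hq2⟩, hc⟩ := hK.exists_mapClusterPt_of_frequently hf
  refine ⟨q, hq1, ?_, fun η hη => chain_of_recur hu hq1 ?_ hη⟩
  · intro hh
    simp only [mem_ofPred_eq, hh, dist_self] at hq2
    linarith
  intro e' he'
  have hN : ∀ᶠ v in 𝓝 q, ∀ i, dist (f (v i)) (f (q i)) < e' ∧ dist (v i) (q i) < e' := by
    rw [eventually_all]
    intro i
    have c1 : Continuous fun v : Bool → X => dist (f (v i)) (f (q i)) :=
      (f.continuous.comp (continuous_apply i)).dist continuous_const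
    have c2 : Continuous fun v : Bool → X => dist (v i) (q i) :=
      (continuous_apply i).dist continuous_const
    exact ((c1.tendsto q).eventually_lt_const (by simpa)).and
      ((c2.tendsto q).eventually_lt_const (by simpa))
  obtain ⟨k, hk, m, hm, hkm⟩ := hl _ (hc.frequently hN)
  exact ⟨k, m, hkm, fun i => (hk i).1.le, fun i => (hm i).2.le⟩

lemma exists_pair [CompactSpace X] {u : Bool → X} (hδ : 0 ≤ δ) (hu : Small f δ u)
    (hne : u true ≠ u false) (hw : NonWandering f (u true)) :
    ∃ q : Bool → X, Small f δ q ∧ q true ≠ q false ∧ ∀ η > 0, TransGen (Step f δ η) q q := by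
  by_cases h1 : Tendsto (fun k : ℤ => dist ((f ^ k) (u true)) ((f ^ k) (u false))) atTop (𝓝 0)
  swap
  · refine exists_pair_of_not_tendsto hu atTop (fun S hS => ?_) h1
    rw [frequently_atTop] at hS
    obtain ⟨k, _, hk⟩ := hS 0
    obtain ⟨m, hm', hm⟩ := hS (k + 2)
    exact ⟨k, hk, m, hm, hm'⟩
  by_cases h2 : Tendsto (fun k : ℤ => dist ((f ^ k) (u true)) ((f ^ k) (u false))) atBot (𝓝 0)
  swap
  · refine exists_pair_of_not_tendsto hu atBot (fun S hS => ?_) h2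
    rw [frequently_atBot] at hS
    obtain ⟨m, _, hm⟩ := hS 0
    obtain ⟨k, hk', hk⟩ := hS (m - 2)
    exact ⟨k, hk, m, hm, by linarith⟩
  refine ⟨u, hu, hne, fun η hη => ?_⟩
  have hS : ∀ v : Unit → X, Small f δ v := fun v k i j => by simpa using hδ
  obtain ⟨k, hk⟩ := eventually_atTop.1 (h1.eventually_lt_const hη)
  obtain ⟨j, hj⟩ := eventually_atBot.1 (h2.eventually_lt_const hη)
  set k' := max k 1
  set j' := min j (-1)
  have hk' := hk (k' + 1) (by have := le_max_left k 1; omega)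
  have hj' := hj j' (min_le_left _ _)
  have s0 : TransGen (Step f δ η) u (it f k' u) := by
    have := hu.orbit hη.le (k := 0) (l := k') (by have := le_max_right k 1; omega)
    rwa [it_zero] at this
  have s1 : Step f δ η (it f k' u) (it f (k' + 1) (fun _ : Bool => u true)) := by
    refine ⟨(hu.it _).base, by simpa [it] using hδ, fun i => ?_⟩
    simp only [it, ← zpow_succ_apply]
    cases i
    · rw [dist_comm]; exact hk'.le
    · simpa using hη.le
  have s2 : TransGen (Step f δ η) (it f (k' + 1) (fun _ : Bool => u true))
      (it f (j' - 1) (fun _ : Bool => u true)) := by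
    have := chain_all (hS _) (fun η hη => chain_of_nonwandering hδ hw hη) (k' + 1) (j' - 1) hη
    exact chain_lift (fun _ : Bool => ()) this
  have s3 : Step f δ η (it f (j' - 1) (fun _ : Bool => u true)) (it f j' u) := by
    refine ⟨by simpa [it] using hδ, (hu.it _).base, fun i => ?_⟩
    simp only [it, ← zpow_succ_apply, sub_add_cancel]
    cases i
    · exact hj'.le
    · simpa using hη.le
  have s4 : TransGen (Step f δ η) (it f j' u) u := by
    have := hu.orbit hη.le (k := j') (l := 0) (by have := min_le_right j (-1); omega)
    rwa [it_zero] at this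
  exact (((s0.tail s1).trans s2).tail s3).trans s4

/-- the four connecting chains -/
lemma exists_quad [CompactSpace X] {ε : ℝ} {p : Bool → X} (hp : Small f δ p)
    (hc : ∀ η > 0, TransGen (Step f δ η) p p) (hδ : 0 ≤ δ) (hε : 0 ≤ ε)
    (hL : ∀ x : ℤ → X, (∀ k : ℤ, dist (f (x k)) (x (k+1)) ≤ δ) →
      Tendsto (fun k : ℤ => dist (f (x k)) (x (k+1))) cofinite (nhds 0) →
      ∃ z : X, (∀ k : ℤ, dist (iterZ f k z) (x k) ≤ ε) ∧
        Tendsto (fun k : ℤ => dist (iterZ f k z) (x k)) cofinite (nhds 0)) (hη : 0 < η) :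
    TransGen (Step f (δ + 2 * ε) η) (p ∘ (Prod.fst : Bool × Bool → Bool)) (p ∘ Prod.snd) := by
  have key : ∀ ij : Bool × Bool, ∃ z : X,
      (∀ k : ℤ, dist ((f ^ k) z) ((f ^ k) (p (if k < 0 then ij.1 else ij.2))) ≤ ε) ∧
      Tendsto (fun k : ℤ => dist ((f ^ k) z) ((f ^ k) (p (if k < 0 then ij.1 else ij.2))))
        cofinite (𝓝 0) := by
    intro ij
    have hz : ∀ k : ℤ, k ≠ -1 → dist (f ((f ^ k) (p (if k < 0 then ij.1 else ij.2))))
        ((f ^ (k + 1)) (p (if k + 1 < 0 then ij.1 else ij.2))) = 0 := by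
      intro k hk
      have : (k + 1 < 0) ↔ (k < 0) := by omega
      simp [this, zpow_succ_apply]
    have := hL (fun k => (f ^ k) (p (if k < 0 then ij.1 else ij.2))) ?_ ?_
    · simpa only [iterZ_eq] using this
    · intro k
      by_cases hk : k = -1
      · subst hk
        simp only [← zpow_succ_apply]
        exact hp _ _ _
      · exact (hz k hk).trans_le hδ
    · refine tendsto_const_nhds.congr' ?_
      have : ∀ᶠ k : ℤ in cofinite, k ≠ -1 := by
        rw [Filter.eventually_cofinite]
        exact (Set.finite_singleton (-1 : ℤ)).subset (fun k hk => by simpa using hk)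
      filter_upwards [this] with k hk using (hz k hk).symm
  choose Z hZ1 hZ2 using key
  have hC : δ ≤ δ + 2 * ε := by linarith
  have hZs : Small f (δ + 2 * ε) Z := by
    intro k a b
    have h1 := hZ1 a k
    have h2 := hZ1 b k
    have h3 := hp k (if k < 0 then a.1 else a.2) (if k < 0 then b.1 else b.2)
    rw [dist_comm] at h2
    have := dist_triangle4 ((f ^ k) (Z a)) ((f ^ k) (p (if k < 0 then a.1 else a.2)))
      ((f ^ k) (p (if k < 0 then b.1 else b.2))) ((f ^ k) (Z b))
    linarith
  have hev : ∀ᶠ k : ℤ in cofinite, ∀ ij, dist ((f ^ k) (Z ij)) ((f ^ k)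
      (p (if k < 0 then ij.1 else ij.2))) < η :=
    eventually_all.2 fun ij => (hZ2 ij).eventually_lt_const hη
  have ht : ∀ᶠ k : ℤ in atTop, ∀ ij, dist ((f ^ k) (Z ij)) ((f ^ k)
      (p (if k < 0 then ij.1 else ij.2))) < η := hev.filter_mono atTop_le_cofinite
  have hb : ∀ᶠ k : ℤ in atBot, ∀ ij, dist ((f ^ k) (Z ij)) ((f ^ k)
      (p (if k < 0 then ij.1 else ij.2))) < η := hev.filter_mono atBot_le_cofinite
  obtain ⟨m, hm, hm0⟩ := (ht.and (eventually_gt_atTop 0)).exists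
  obtain ⟨n, hn, hn0⟩ := (hb.and (eventually_lt_atBot 0)).exists
  simp only [if_pos hn0, if_neg hm0.not_gt] at hm hn
  have hps : ∀ φ : Bool × Bool → Bool, Small f (δ + 2 * ε) (p ∘ φ) :=
    fun φ k i j => (hp k _ _).trans hC
  have s0 : TransGen (Step f (δ + 2 * ε) η) (p ∘ (Prod.fst : Bool × Bool → Bool))
      (it f (n - 1) (p ∘ Prod.fst)) := by
    have := chain_all hp hc 0 (n - 1) hη
    rw [it_zero] at this
    exact chain_mono hC le_rfl (chain_lift (Prod.fst : Bool × Bool → Bool) this)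
  have s1 : Step f (δ + 2 * ε) η (it f (n - 1) (p ∘ (Prod.fst : Bool × Bool → Bool)))
      (it f n Z) := by
    refine ⟨((hps _).it _).base, (hZs.it _).base, fun i => ?_⟩
    simp only [it, ← zpow_succ_apply, sub_add_cancel]
    rw [dist_comm]; exact (hn i).le
  have s2 : TransGen (Step f (δ + 2 * ε) η) (it f n Z) (it f (m - 1) Z) ∨ n = m - 1 := by
    rcases (show n ≤ m - 1 by omega).lt_or_eq with h | h
    · exact Or.inl (hZs.orbit hη.le h)
    · exact Or.inr h
  have s2 := hZs.rorbit (η := η) hη.le (show n ≤ m - 1 by omega)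
  have s3 : Step f (δ + 2 * ε) η (it f (m - 1) Z)
      (it f m (p ∘ (Prod.snd : Bool × Bool → Bool))) := by
    refine ⟨(hZs.it _).base, ((hps _).it _).base, fun i => ?_⟩
    simp only [it, ← zpow_succ_apply, sub_add_cancel]
    exact (hm i).le
  have s4 : TransGen (Step f (δ + 2 * ε) η) (it f m (p ∘ Prod.snd))
      (p ∘ (Prod.snd : Bool × Bool → Bool)) := by
    have := chain_all hp hc m 0 hη
    rw [it_zero] at this
    exact chain_mono hC le_rfl (chain_lift (Prod.snd : Bool × Bool → Bool) this)
  exact (((s0.tail s1).trans_left s2).tail s3).trans s4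

lemma exists_seq {α : Type*} {r : α → α → Prop} {a b : α} (h : TransGen r a b) :
    ∃ (L : ℕ) (u : ℕ → α), 0 < L ∧ u 0 = a ∧ u L = b ∧ ∀ t < L, r (u t) (u (t + 1)) := by
  induction h with
  | single h =>
    rename_i b
    refine ⟨1, fun n => if n = 0 then a else b, one_pos, by simp, by simp, ?_⟩
    intro t ht
    obtain rfl : t = 0 := by omega
    simpa using h
  | tail _ h ih =>
    rename_i b c _
    obtain ⟨L, u, hL, h0, h1, h2⟩ := ih
    refine ⟨L + 1, fun n => if n ≤ L then u n else c, by omega, by simpa using h0, by simp, ?_⟩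
    intro t ht
    rcases (show t < L ∨ t = L by omega) with h' | rfl
    · have e1 : t ≤ L := by omega
      have e2 : t + 1 ≤ L := by omega
      simpa [e1, e2] using h2 t h'
    · simpa [h1] using h

/-- Shadowing from L-shadowing. -/
lemma shadow [CompactSpace X] (hL : LShadowing f) {ε : ℝ} (hε : 0 < ε) :
    ∃ η > (0:ℝ), ∀ x : ℤ → X, (∀ k : ℤ, dist (f (x k)) (x (k+1)) ≤ η) →
      ∃ z : X, ∀ k : ℤ, dist ((f ^ k) z) (x k) ≤ ε := by
  obtain ⟨η, hη, H⟩ := hL ε hε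
  refine ⟨η, hη, fun x hx => ?_⟩
  have key : ∀ n : ℕ, ∃ z : X, ∀ k : ℤ, |k| ≤ n → dist ((f ^ k) z) (x k) ≤ ε := by
    intro n
    let y : ℤ → X := fun k => if k < -n then (f ^ (k + n)) (x (-n)) else
      if k ≤ n then x k else (f ^ (k - n)) (x n)
    have hy : ∀ k : ℤ, k < -n ∨ n ≤ k → f (y k) = y (k + 1) := by
      rintro k (hk | hk)
      · by_cases h' : k + 1 < -n
        · simp only [y, if_pos hk, if_pos h', ← zpow_succ_apply]
          congr 2; ring
        · have e : k + 1 = -n := by omega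
          have e2 : k + n = -1 := by omega
          simp only [y, if_pos hk, if_neg h', if_pos (show k + 1 ≤ n by omega), e2,
            ← zpow_succ_apply]
          rw [e]; simp
      · have a1 : ¬ (k < -n) := by omega
        have a2 : ¬ (k + 1 < -n) := by omega
        have a3 : ¬ (k + 1 ≤ n) := by omega
        by_cases h' : k ≤ n
        · have e : k = n := by omega
          simp only [y, if_neg a1, if_neg a2, if_neg a3, if_pos h']
          rw [e, show (n : ℤ) + 1 - n = 1 by ring, zpow_one]
        · simp only [y, if_neg a1, if_neg a2, if_neg a3, if_neg h', ← zpow_succ_apply]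
          congr 2; ring
    have hy' : ∀ k : ℤ, |k| ≤ n → y k = x k := by
      intro k hk
      rw [abs_le] at hk
      simp only [y, if_neg (show ¬ k < -n by omega), if_pos hk.2]
    have hobt := H y ?_ ?_
    · obtain ⟨z, hz, -⟩ := hobt
      refine ⟨z, fun k hk => ?_⟩
      have := hz k
      rwa [iterZ_eq, hy' k hk] at this
    · intro k
      by_cases h : k < -n ∨ n ≤ k
      · rw [hy k h]; simpa using hη.le
      · rw [hy' k (by rw [abs_le]; omega), hy' (k + 1) (by rw [abs_le]; omega)]
        exact hx k
    · refine tendsto_const_nhds.congr' ?_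
      have : ∀ᶠ k : ℤ in cofinite, k < -n ∨ n ≤ k := by
        rw [Filter.eventually_cofinite]
        refine (Set.finite_Icc (-n : ℤ) n).subset fun k hk => ?_
        simp only [mem_ofPred_eq] at hk
        simp only [Set.mem_Icc]; omega
      filter_upwards [this] with k hk
      rw [hy k hk, dist_self]
  choose z hz using key
  obtain ⟨a, -, ha⟩ := (isCompact_univ (X := X)).exists_mapClusterPt_of_frequently
    (l := (atTop : Filter ℕ)) (f := z) (Frequently.of_forall fun _ => mem_univ _)
  refine ⟨a, fun k => ?_⟩
  have hcl : IsClosed {w | dist ((f ^ k) w) (x k) ≤ ε} :=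
    isClosed_le ((f ^ k).continuous.dist continuous_const) continuous_const
  have hev : ∀ᶠ n in atTop, z n ∈ {w | dist ((f ^ k) w) (x k) ≤ ε} := by
    filter_upwards [eventually_ge_atTop k.natAbs] with n hn
    exact hz n k (by rw [Int.abs_eq_natAbs]; exact_mod_cast hn)
  exact hcl.mem_of_mapClusterPt ha hev

/-- The bi-infinite concatenation of the connecting chains coded by `s`. -/
def cat (L : ℕ) (u : ℕ → (Bool × Bool) → X) (s : ℤ → Bool) (k : ℤ) : X :=
  u (k % L).toNat (s (k / L), s (k / L + 1))

lemma cat_step {L : ℕ} (hL : 0 < L) {p : Bool → X} {u : ℕ → (Bool × Bool) → X}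
    (h0 : u 0 = p ∘ Prod.fst) (h1 : u L = p ∘ Prod.snd)
    (h : ∀ t < L, Step f δ η (u t) (u (t + 1))) (s : ℤ → Bool) (k : ℤ) :
    dist (f (cat L u s k)) (cat L u s (k + 1)) ≤ η := by
  have hL' : (0 : ℤ) < L := by exact_mod_cast hL
  obtain ⟨q, t, ht, rfl⟩ : ∃ (q : ℤ) (t : ℕ), t < L ∧ k = t + L * q := by
    refine ⟨k / L, (k % L).toNat, ?_, ?_⟩
    · have := Int.emod_lt_of_pos k hL'
      omega
    · rw [Int.toNat_of_nonneg (Int.emod_nonneg _ hL'.ne')]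
      exact (Int.emod_add_mul_ediv k L).symm
  have A : ∀ (t : ℕ) (q : ℤ), t < L → cat L u s (t + L * q) = u t (s q, s (q + 1)) := by
    intro t q ht
    have e1 : ((t : ℤ) + L * q) % L = t := by
      rw [Int.add_mul_emod_self_left]
      exact Int.emod_eq_of_lt (by omega) (by omega)
    have e2 : ((t : ℤ) + L * q) / L = q := by
      rw [Int.add_mul_ediv_left _ _ hL'.ne', Int.ediv_eq_zero_of_lt (by omega) (by omega), zero_add]
    simp only [cat, e1, e2, Int.toNat_natCast]
  rw [A t q ht]
  by_cases h' : t + 1 < L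
  · have := A (t + 1) q h'
    rw [show (t : ℤ) + L * q + 1 = ((t + 1 : ℕ) : ℤ) + L * q by push_cast; ring, this]
    exact (h t ht).2.2 _
  · obtain rfl : L = t + 1 := by omega
    have := A 0 (q + 1) hL
    rw [show (t : ℤ) + ((t + 1 : ℕ) : ℤ) * q + 1
      = ((0 : ℕ) : ℤ) + ((t + 1 : ℕ) : ℤ) * (q + 1) by push_cast; ring, this]
    have h2 := (h t ht).2.2 (s q, s (q + 1))
    rw [h1] at h2
    rw [h0]
    exact h2

theorem horseshoe [CompactSpace X] (hL : LShadowing f) {c : ℝ} (hc : 0 < c)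
    (hne : ¬ ExpansiveOn f (omegaSet f)) :
    ∃ p0 ∈ omegaSet f, ∃ L : ℕ, 0 < L ∧ ∃ r > 0, ∃ P : (ℕ → Bool) → X,
      (∀ s, P s ∈ dynBall f c p0) ∧
      ∀ s s' (n : ℕ), s n ≠ s' n → 2 * r ≤ dist ((⇑f)^[L * n] (P s)) ((⇑f)^[L * n] (P s')) := by
  set ε := c / 5 with hε
  have hε0 : 0 < ε := by positivity
  obtain ⟨δ0, hδ0, HL⟩ := hL ε hε0
  set δ := min δ0 ε with hδ
  have hδpos : 0 < δ := lt_min hδ0 hε0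
  unfold ExpansiveOn at hne
  push Not at hne
  obtain ⟨x, hx, y, hy, hxy, hxy'⟩ := hne δ hδpos
  have hu : Small f δ (fun b : Bool => if b then x else y) := by
    intro k i j
    have := hxy k
    rw [iterZ_eq, iterZ_eq] at this
    cases i <;> cases j <;> simp [hδpos.le, this]
    rwa [dist_comm]
  obtain ⟨p, hp, hpne, hpc⟩ := exists_pair hδpos.le hu (by simpa using hxy')
    (show NonWandering f x from hx)
  have hd : 0 < dist (p true) (p false) := dist_pos.2 hpne
  set d := dist (p true) (p false) with hdd
  obtain ⟨η, hη, HS⟩ := shadow hL (lt_min hε0 (show 0 < d / 4 by positivity))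
  have hquad := exists_quad hp hpc hδpos.le hε0.le
    (fun x hx => HL x (fun k => (hx k).trans (min_le_left _ _))) hη
  obtain ⟨L, u, hLp, hu0, huL, hus⟩ := exists_seq hquad
  have hLz : (0 : ℤ) < L := by exact_mod_cast hLp
  have hsh := fun s : ℤ → Bool => HS (cat L u s) (cat_step hLp hu0 huL hus s)
  choose Q hQ using hsh
  -- closeness of the coded sequences
  have hclose : ∀ s s' k, dist (cat L u s k) (cat L u s' k) ≤ 3 * ε := by
    intro s s' k
    have := (hus (k % L).toNat (by
      have := Int.emod_lt_of_pos k hLz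
      have := Int.emod_nonneg k hLz.ne'
      omega)).1 (s (k / L), s (k / L + 1)) (s' (k / L), s' (k / L + 1))
    have h2 : δ ≤ ε := min_le_right _ _
    exact this.trans (by linarith)
  -- the base point
  let s0 : ℤ → Bool := fun _ => true
  have hper : ∀ k : ℤ, ∀ n : ℕ, cat L u s0 (k + L * n) = cat L u s0 k := by
    intro k n
    simp [cat, s0]
  let K : Set X := {z | ∀ k : ℤ, dist ((f ^ k) z) (cat L u s0 k) ≤ min ε (d / 4)}
  have hKcl : IsClosed K := by
    have : K = ⋂ k : ℤ, {z | dist ((f ^ k) z) (cat L u s0 k) ≤ min ε (d / 4)} := by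
      ext z; simp [K]
    rw [this]
    exact isClosed_iInter fun k =>
      isClosed_le ((f ^ k).continuous.dist continuous_const) continuous_const
  have hKorb : ∀ n : ℕ, (⇑f)^[L * n] (Q s0) ∈ K := by
    intro n k
    rw [← pow_apply, ← zpow_natCast, ← zpow_add_apply, ← hper k n]
    push_cast
    exact hQ s0 (k + L * n)
  obtain ⟨p0, hp0, hcl⟩ := hKcl.isCompact.exists_mapClusterPt_of_frequently
    (l := (atTop : Filter ℕ)) (f := fun n => (⇑f)^[L * n] (Q s0)) (Frequently.of_forall hKorb)
  refine ⟨p0, ?_, L, hLp, d / 4, by positivity,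
    fun s => Q (fun k => s k.toNat), fun s k => ?_, fun s s' n hn => ?_⟩
  · intro U hU hpU
    have hfr := frequently_atTop.1 (hcl.frequently (hU.mem_nhds hpU))
    obtain ⟨n, -, hn⟩ := hfr 0
    obtain ⟨m, hm, hm'⟩ := hfr (n + 1)
    obtain ⟨j, rfl⟩ : ∃ j, m = n + 1 + j := ⟨m - (n + 1), by omega⟩
    refine ⟨L * (j + 1), by positivity, (⇑f)^[L * (n + 1 + j)] (Q s0), ⟨_, hn, ?_⟩, hm'⟩
    rw [← Function.iterate_add_apply]
    congr 2
    ring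
  · rw [iterZ_eq, iterZ_eq]
    have h1 := hp0 k
    have h2 := hQ (fun k => s k.toNat) k
    have h3 := hclose s0 (fun k => s k.toNat) k
    have h4 := dist_triangle4 ((f ^ k) p0) (cat L u s0 k) (cat L u (fun k => s k.toNat) k)
      ((f ^ k) (Q (fun k => s k.toNat)))
    rw [dist_comm] at h2
    have h5 := min_le_left ε (d / 4)
    linarith
  · have hcat : ∀ s : ℤ → Bool, cat L u s (((L * n : ℕ) : ℤ)) = p (s n) := by
      intro s
      simp [cat, hu0]
      rw [Int.mul_ediv_cancel_left _ hLz.ne']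
    have h1 := hQ (fun k => s k.toNat) ((L * n : ℕ) : ℤ)
    have h2 := hQ (fun k => s' k.toNat) ((L * n : ℕ) : ℤ)
    rw [hcat, zpow_natCast, pow_apply] at h1 h2
    simp only [Int.toNat_natCast] at h1 h2
    have h3 : dist (p (s n)) (p (s' n)) = d := by
      rcases hs : s n <;> rcases hs' : s' n <;> simp_all [dist_comm]
    rw [dist_comm] at h1
    have h4 := dist_triangle4 (p (s n)) ((⇑f)^[L * n] (Q (fun k => s k.toNat)))
      ((⇑f)^[L * n] (Q (fun k => s' k.toNat))) (p (s' n))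
    have h5 := min_le_right ε (d / 4)
    linarith

lemma entropy_pos {F : Set X} {L : ℕ} (hL : 0 < L) {r : ℝ} (hr : 0 < r) {P : (ℕ → Bool) → X}
    (hP : ∀ s, P s ∈ F)
    (hsep : ∀ s s' (n : ℕ), s n ≠ s' n →
      2 * r ≤ dist ((⇑f)^[L * n] (P s)) ((⇑f)^[L * n] (P s'))) :
    Dynamics.coverEntropy (⇑f) F ≠ 0 := by
  classical
  let U : SetRel X X := {q | dist q.1 q.2 < r}
  have hU : U ∈ uniformity X := Metric.dist_mem_uniformity hr
  have hmain : ∀ n : ℕ, ((2 : ENNReal) ^ n) ≤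
      ((Dynamics.netMaxcard (⇑f) F U (L * n) : ℕ∞) : ENNReal) := by
    intro n
    let e : (Fin n → Bool) → (ℕ → Bool) := fun s k => if h : k < n then s ⟨k, h⟩ else false
    have hdiff : ∀ s s' : Fin n → Bool, s ≠ s' → ∃ k < n, e s k ≠ e s' k := by
      intro s s' hs
      obtain ⟨i, hi⟩ := Function.ne_iff.1 hs
      exact ⟨i, i.2, by simpa [e] using hi⟩
    have hinj : Function.Injective fun s => P (e s) := by
      intro s s' hss
      by_contra hne
      obtain ⟨k, hk, hk'⟩ := hdiff s s' hne
      have := hsep _ _ k hk'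
      simp only at hss
      rw [hss, dist_self] at this
      linarith
    have hnet : Dynamics.IsDynNetIn (⇑f) F U (L * n)
        ((Finset.univ.image fun s => P (e s) : Finset X) : Set X) := by
      constructor
      · intro x hx
        simp only [Finset.coe_image, Finset.coe_univ, image_univ, mem_range] at hx
        obtain ⟨s, rfl⟩ := hx
        exact hP _
      · intro x hx y hy hxy
        simp only [Finset.coe_image, Finset.coe_univ, image_univ, mem_range] at hx hy
        obtain ⟨s, rfl⟩ := hx
        obtain ⟨s', rfl⟩ := hy
        obtain ⟨k, hk, hk'⟩ := hdiff s s' (fun h => hxy (by rw [h]))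
        have h1 := hsep _ _ k hk'
        rw [Function.onFun, Set.disjoint_left]
        intro z hz hz'
        rw [Dynamics.mem_ball_dynEntourage] at hz hz'
        have hlt : L * k < L * n := Nat.mul_lt_mul_of_pos_left hk hL
        have a1 : dist ((⇑f)^[L * k] (P (e s))) ((⇑f)^[L * k] z) < r := hz _ hlt
        have a2 : dist ((⇑f)^[L * k] (P (e s'))) ((⇑f)^[L * k] z) < r := hz' _ hlt
        have := dist_triangle_right ((⇑f)^[L * k] (P (e s))) ((⇑f)^[L * k] (P (e s')))
          ((⇑f)^[L * k] z)
        linarith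
    have := hnet.card_le_netMaxcard
    rw [Finset.card_image_of_injective _ hinj] at this
    simp only [Finset.card_univ, Fintype.card_pi, Fintype.card_bool, Finset.prod_const,
      Fintype.card_fin] at this
    have h2 := ENat.toENNReal_le.2 this
    simpa using h2
  intro h0
  have h1 := Dynamics.netEntropyEntourage_le_coverEntropy (T := ⇑f) (F := F) hU
  rw [h0, Dynamics.netEntropyEntourage] at h1
  have hmono : Monotone fun n : ℕ =>
      ((Dynamics.netMaxcard (⇑f) F U n : ℕ∞) : ENNReal) := fun a b hab =>
    ENat.toENNReal_le.2 (Dynamics.netMaxcard_monotone_time (⇑f) F U hab)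
  have h2 := hmono.expGrowthSup_comp_mul hL.ne'
  have h3 : ENNReal.log 2 ≤ (L : EReal) * ExpGrowth.expGrowthSup fun n : ℕ =>
      ((Dynamics.netMaxcard (⇑f) F U n : ℕ∞) : ENNReal) := by
    rw [← h2, ← ExpGrowth.expGrowthSup_pow]
    exact ExpGrowth.expGrowthSup_monotone hmain
  have h4 : (0 : EReal) < ENNReal.log 2 := by
    rw [← ENNReal.log_one]
    exact ENNReal.log_strictMono (by norm_num)
  have h5 : (L : EReal) * (ExpGrowth.expGrowthSup fun n : ℕ =>
      ((Dynamics.netMaxcard (⇑f) F U n : ℕ∞) : ENNReal)) ≤ 0 := by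
    calc _ ≤ (L : EReal) * 0 := mul_le_mul_of_nonneg_left h1 (by positivity)
      _ = 0 := mul_zero _
  exact absurd (h3.trans h5) (not_le.2 h4)

lemma not_countable {F : Set X} {L : ℕ} {r : ℝ} (hr : 0 < r) {P : (ℕ → Bool) → X}
    (hP : ∀ s, P s ∈ F)
    (hsep : ∀ s s' (n : ℕ), s n ≠ s' n →
      2 * r ≤ dist ((⇑f)^[L * n] (P s)) ((⇑f)^[L * n] (P s'))) :
    ¬ F.Countable := by
  intro hF
  have hinj : Function.Injective P := by
    intro s s' hss
    by_contra hne
    obtain ⟨k, hk⟩ := Function.ne_iff.1 hne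
    have := hsep _ _ k hk
    rw [hss, dist_self] at this
    linarith
  have h1 : (P ⁻¹' F).Countable := hF.preimage hinj
  have h2 : P ⁻¹' F = univ := eq_univ_of_forall hP
  rw [h2, Set.countable_univ_iff] at h1
  have : Countable (Set ℕ) := by
    classical
    refine Function.Injective.countable (f := fun (A : Set ℕ) (n : ℕ) => decide (n ∈ A)) ?_
    intro A B hAB
    ext n
    simpa using congrFun hAB n
  obtain ⟨g, hg⟩ := exists_injective_nat (Set ℕ)
  exact Function.cantor_injective g hg

end LSh

/-- under L-shadowing, countable- or entropy-expansivity of the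
non-wandering set implies its expansivity. -/
theorem omega_expansive_of_countable_or_entropy_expansive [CompactSpace X] (f : X ≃ₜ X)
    (hL : LShadowing f)
    (h : (∃ c > (0:ℝ), ∀ x ∈ omegaSet f, (dynBall f c x).Countable) ∨
         (∃ c > (0:ℝ), ∀ x ∈ omegaSet f, Dynamics.coverEntropy (⇑f) (dynBall f c x) = 0)) :
    ExpansiveOn f (omegaSet f) := by
  by_contra hne
  rcases h with ⟨c, hc, h⟩ | ⟨c, hc, h⟩
  · obtain ⟨p0, hp0, L, hLp, r, hr, P, hP, hsep⟩ := LSh.horseshoe hL hc hne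
    exact LSh.not_countable hr hP hsep (h p0 hp0)
  · obtain ⟨p0, hp0, L, hLp, r, hr, P, hP, hsep⟩ := LSh.horseshoe hL hc hne
    exact LSh.entropy_pos hLp hr hP hsep (h p0 hp0)
end
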